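/- arXiv:1508.07299 — 3 statements merged into one kernel-verified Lean document; each statement's English description precedes it below -/
import Mathlib

section
/- The pebbling number of the Bruhat graph B_4 of order 4 equals 64; that is, π(B_4) = 64. -/
/-- A single pebbling move on a graph `G`: remove two pebbles from a vertex `u`
(which must carry at least two pebbles) and add one pebble on a neighbor `v` of `u`. -/
def PebblingMove {V : Type*} (G : SimpleGraph V) (p q : V → ℕ) : Prop :=
  ∃ u v : V, G.Adj u v ∧ 2 ≤ p u ∧ q u = p u - 2 ∧ q v = p v + 1 ∧
    ∀ x : V, x ≠ u → x ≠ v → q x = p x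

/-- A configuration `p` is solvable for the root `r` if some sequence of pebbling moves
starting from `p` produces a configuration with at least one pebble on `r`. -/
def PebblingSolvable {V : Type*} (G : SimpleGraph V) (r : V) (p : V → ℕ) : Prop :=
  ∃ q : V → ℕ, Relation.ReflTransGen (PebblingMove G) p q ∧ 1 ≤ q r

/-- The rooted pebbling number `π(G, r)`: the least `k` such that every configuration
of size `k` is solvable for the root `r`. -/
noncomputable def rootedPebblingNumber {V : Type*} [Fintype V] (G : SimpleGraph V) (r : V) : ℕ :=
  sInf {k : ℕ | ∀ p : V → ℕ, (∑ v, p v) = k → PebblingSolvable G r p}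

/-- The pebbling number `π(G)`: the least `k` such that for every root `r`, every
configuration of size `k` is solvable for `r`. -/
noncomputable def pebblingNumber {V : Type*} [Fintype V] (G : SimpleGraph V) : ℕ :=
  sInf {k : ℕ | ∀ (r : V) (p : V → ℕ), (∑ v, p v) = k → PebblingSolvable G r p}

/-- A graph is Class 0 if its pebbling number equals its number of vertices. -/
def Class0 {V : Type*} [Fintype V] (G : SimpleGraph V) : Prop :=
  pebblingNumber G = Fintype.card V

/-- The Bruhat graph of order 4: vertices are the permutations of `{1,2,3,4}`
(modeled as `Equiv.Perm (Fin 4)`), two permutations adjacent iff one is obtained from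
the other by composing with an adjacent transposition `(i, i+1)`. -/
def bruhatB4 : SimpleGraph (Equiv.Perm (Fin 4)) :=
  SimpleGraph.fromRel fun σ τ => ∃ i : Fin 3, τ = σ * Equiv.swap i.castSucc i.succ

namespace Pebbling

section General

variable {V W : Type*} {G : SimpleGraph V}

lemma solvable_of_reflTransGen {r : V} {p q : V → ℕ}
    (h : Relation.ReflTransGen (PebblingMove G) p q) (hq : PebblingSolvable G r q) :
    PebblingSolvable G r p :=
  let ⟨q', hq', hr⟩ := hq
  ⟨q', h.trans hq', hr⟩

lemma eq_zero_of_not_solvable {r : V} {p : V → ℕ} (h : ¬ PebblingSolvable G r p) : p r = 0 := by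
  by_contra h0
  exact h ⟨p, .refl, Nat.one_le_iff_ne_zero.2 h0⟩

lemma solvable_of_equiv {G' : SimpleGraph W} (e : V ≃ W)
    (he : ∀ a b, G.Adj a b → G'.Adj (e a) (e b)) {r : V} {p : W → ℕ}
    (h : PebblingSolvable G r (p ∘ e)) : PebblingSolvable G' (e r) p := by
  obtain ⟨q, hq, hr⟩ := h
  refine ⟨q ∘ e.symm, ?_, by simpa using hr⟩
  have := hq.lift (p := PebblingMove G') (fun q : V → ℕ => q ∘ e.symm) ?_
  · simpa [Function.onFun, Function.comp_assoc] using this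
  · rintro a b ⟨u, v, huv, h2, hu, hv, hx⟩
    refine ⟨e u, e v, he _ _ huv, by simpa using h2, by simpa using hu, by simpa using hv,
      fun x hxu hxv => hx _ ?_ ?_⟩
    · rintro rfl; simp at hxu
    · rintro rfl; simp at hxv

variable [DecidableEq V]

lemma exists_eq_add_single {p : V → ℕ} {u : V} {k : ℕ} (h : k ≤ p u) :
    ∃ c : V → ℕ, p = c + Pi.single u k := by
  refine ⟨p - Pi.single u k, ?_⟩
  ext x
  by_cases hx : x = u
  · subst hx; simp [h]
  · simp [hx]

lemma move_single {u v : V} (h : G.Adj u v) (c : V → ℕ) :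
    PebblingMove G (c + Pi.single u 2) (c + Pi.single v 1) := by
  refine ⟨u, v, h, by simp, by simp [h.ne], by simp [h.ne'], fun x hu hv => by simp [hu, hv]⟩

lemma exists_of_move {p q : V → ℕ} (h : PebblingMove G p q) :
    ∃ u v, ∃ c : V → ℕ, G.Adj u v ∧ p = c + Pi.single u 2 ∧ q = c + Pi.single v 1 := by
  obtain ⟨u, v, h, h2, hu, hv, hx⟩ := h
  obtain ⟨c, rfl⟩ := exists_eq_add_single h2
  refine ⟨u, v, c, h, rfl, ?_⟩
  ext x
  by_cases hxu : x = u
  · subst hxu; simp [h.ne, hu]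
  · by_cases hxv : x = v
    · subst hxv; simp [hxu, hv]
    · simp [hxu, hxv, hx]

/-- Moving `2 ^ n` pebbles along a walk of length `n` delivers one pebble to its end. -/
lemma reflTransGen_of_walk {s f : V} (q : G.Walk s f) (m : ℕ) (c : V → ℕ) :
    Relation.ReflTransGen (PebblingMove G) (c + Pi.single s (2 ^ q.length * m))
      (c + Pi.single f m) := by
  have step : ∀ {u v : V} (_ : G.Adj u v) (k : ℕ) (c : V → ℕ),
      Relation.ReflTransGen (PebblingMove G) (c + Pi.single u (2 * k)) (c + Pi.single v k) := by
    intro u v h k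
    induction k with
    | zero => intro c; simpa using Relation.ReflTransGen.refl
    | succ k ih =>
      intro c
      have h1 := move_single h (c + Pi.single u (2 * k))
      have h2 := ih (c + Pi.single v 1)
      rw [add_right_comm] at h2
      refine .head (b := c + Pi.single u (2 * k) + Pi.single v 1) ?_ ?_
      · rwa [add_assoc, ← Pi.single_add] at h1
      · rwa [add_assoc c (Pi.single v 1), ← Pi.single_add, add_comm 1 k] at h2
  induction q with
  | nil => simpa using Relation.ReflTransGen.refl
  | cons h q ih =>
    refine .trans ?_ ih
    rw [SimpleGraph.Walk.length_cons, pow_succ', mul_assoc]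
    exact step h _ c

variable [Fintype V]

lemma sum_mul_add_single (w c : V → ℕ) (u : V) (k : ℕ) :
    ∑ v, w v * (c + Pi.single u k : V → ℕ) v = ∑ v, w v * c v + w u * k := by
  simp [mul_add, Finset.sum_add_distrib, Pi.single_apply]

/-- If `w` at most doubles along every edge, then moves do not increase the total weight. -/
lemma not_solvable_of_weight {w p : V → ℕ} {r : V} (hw : ∀ u v, G.Adj u v → w v ≤ 2 * w u)
    (hp : ∑ v, w v * p v < w r) : ¬ PebblingSolvable G r p := by
  rintro ⟨q, hq, hr⟩
  have hle : ∑ v, w v * q v ≤ ∑ v, w v * p v := by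
    clear hr
    induction hq with
    | refl => exact le_rfl
    | tail _ hm ih =>
      obtain ⟨u, v, c, h, rfl, rfl⟩ := exists_of_move hm
      simp only [sum_mul_add_single] at ih ⊢
      have := hw u v h
      omega
  have : w r * q r ≤ ∑ v, w v * q v :=
    Finset.single_le_sum (f := fun v => w v * q v) (fun _ _ => Nat.zero_le _) (Finset.mem_univ r)
  nlinarith

/-- The weight bound: `w` at least doubles along some edge leaving each vertex of its support,
unless that edge enters the root. Vertices of `F` carry an even number of pebbles and
are never used as intermediate stops, so they do not contribute to the bound. -/
lemma weight_le_of_even {r : V} {w : V → ℕ} {F : Finset V}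
    (hw : ∀ v, 0 < w v → ∃ u, G.Adj v u ∧ (u = r ∨ u ∉ F ∧ 2 * w v ≤ w u))
    {p : V → ℕ} (hF : ∀ v ∈ F, Even (p v)) (hp : ¬ PebblingSolvable G r p) :
    ∑ v, w v * p v ≤ ∑ v ∈ Fᶜ, w v := by
  induction hn : ∑ v, p v using Nat.strong_induction_on generalizing p with
  | _ n ih =>
    by_contra! hlt
    obtain ⟨v, hv, hpv⟩ : ∃ v, 0 < w v ∧ 2 ≤ p v := by
      by_contra! h
      refine hlt.not_ge ?_
      rw [← Finset.sum_add_sum_compl F, Finset.sum_eq_zero, zero_add]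
      · refine Finset.sum_le_sum fun v _ => ?_
        rcases Nat.eq_zero_or_pos (w v) with h0 | h0
        · simp [h0]
        · have := h v h0
          nlinarith
      · intro v hv
        rcases Nat.eq_zero_or_pos (w v) with h0 | h0
        · simp [h0]
        · have h1 := h v h0
          obtain ⟨k, hk⟩ := hF v hv
          rw [show p v = 0 by omega, mul_zero]
    obtain ⟨u, hvu, hu⟩ := hw v hv
    obtain ⟨c, rfl⟩ := exists_eq_add_single hpv
    have hmove := Relation.ReflTransGen.single (move_single hvu c)
    rcases hu with rfl | ⟨huF, huw⟩
    · exact hp ⟨_, hmove, by simp⟩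
    · have hsum := fun x (k : ℕ) => sum_mul_add_single 1 c x k
      simp only [Pi.one_apply, one_mul] at hsum
      have := ih (∑ x, (c + Pi.single u 1 : V → ℕ) x) (by rw [← hn, hsum, hsum]; omega)
        (p := c + Pi.single u 1) ?_ (fun h => hp (solvable_of_reflTransGen hmove h)) rfl
      · rw [sum_mul_add_single] at this hlt
        omega
      · intro x hx
        have hxu : x ≠ u := fun h => huF (h ▸ hx)
        have := hF x hx
        by_cases hxv : x = v
        · subst hxv; simpa [hxu, Nat.even_add] using this
        · simpa [hxu, hxv] using this

/-- The weight bound with parity correction: if a vertex `s` carries enough pebbles to send one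
to each vertex of `F`, then no parity assumption on `F` is needed. -/
lemma weight_le_of_source {r s : V} {w d : V → ℕ} {F : Finset V}
    (hw : ∀ v, 0 < w v → ∃ u, G.Adj v u ∧ (u = r ∨ u ∉ F ∧ 2 * w v ≤ w u))
    (hd : ∀ f ∈ F, ∃ q : G.Walk s f, q.length = d f)
    (hF : ∀ f ∈ F, f ≠ s ∧ 2 ^ d f * w s ≤ w f)
    {p : V → ℕ} (hs : ∑ f ∈ F, 2 ^ d f ≤ p s) (hp : ¬ PebblingSolvable G r p) :
    ∑ v, w v * p v ≤ ∑ v ∈ Fᶜ, w v := by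
  set O := F.filter fun f => Odd (p f) with hO
  have hOF : O ⊆ F := Finset.filter_subset _ _
  have send : ∀ A ⊆ F, ∀ c : V → ℕ, Relation.ReflTransGen (PebblingMove G)
      (c + Pi.single s (∑ f ∈ A, 2 ^ d f)) (c + ∑ f ∈ A, Pi.single f 1) := by
    intro A
    induction A using Finset.induction_on with
    | empty => intro _ c; simpa using Relation.ReflTransGen.refl
    | insert a A ha ih =>
      intro hA c
      obtain ⟨q, hq⟩ := hd a (hA (Finset.mem_insert_self _ _))
      have h1 := reflTransGen_of_walk q 1 (c + Pi.single s (∑ f ∈ A, 2 ^ d f))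
      have h2 := ih ((Finset.subset_insert _ _).trans hA) (c + Pi.single a 1)
      rw [Finset.sum_insert ha, Finset.sum_insert ha, Pi.single_add, ← hq, ← add_assoc,
        ← add_assoc]
      rw [mul_one, add_right_comm] at h1
      rw [add_right_comm] at h2
      exact h1.trans h2
  obtain ⟨c, hc⟩ := exists_eq_add_single ((Finset.sum_le_sum_of_subset hOF).trans hs)
  have hreach := send O hOF c
  rw [← hc] at hreach
  have key := weight_le_of_even hw (p := c + ∑ f ∈ O, Pi.single f 1) ?_
    (fun h => hp (solvable_of_reflTransGen hreach h))
  · refine le_trans ?_ key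
    have hsum : ∑ v, w v * (c + ∑ f ∈ O, Pi.single f 1 : V → ℕ) v =
        ∑ v, w v * c v + ∑ f ∈ O, w f := by
      simp [mul_add, Finset.sum_add_distrib, Finset.sum_apply, Pi.single_apply]
    rw [hsum, hc, sum_mul_add_single, Finset.mul_sum]
    gcongr with f hf
    rw [mul_comm]
    exact (hF f (hOF hf)).2
  · intro f hf
    have hpf : p f = c f := by rw [hc]; simp [(hF f hf).1]
    have hcount : (∑ f ∈ O, Pi.single f 1 : V → ℕ) f = if Odd (p f) then 1 else 0 := by
      simp [Finset.sum_apply, Pi.single_apply, hO, hf]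
    rw [Pi.add_apply, hcount, ← hpf]
    split_ifs with h
    · exact h.add_one
    · simpa using h

end General

/-- The Cayley graph of `S₄` on the adjacent transpositions, with the vertices numbered by
nondecreasing length: `neighbor a i` is obtained from `a` by the `i`-th transposition. -/
def neighbor : Fin 24 → Fin 3 → Fin 24 :=
  ![![1, 2, 3], ![0, 4, 5], ![6, 0, 7], ![5, 8, 0], ![9, 1, 10], ![3, 11, 1], ![2, 9, 12],
    ![12, 13, 2], ![14, 3, 13], ![4, 6, 15], ![15, 16, 4], ![17, 5, 16], ![7, 18, 6],
    ![19, 7, 8], ![8, 17, 19], ![10, 20, 9], ![21, 10, 11], ![11, 14, 21], ![22, 12, 20],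
    ![13, 22, 14], ![23, 15, 18], ![16, 23, 17], ![18, 19, 23], ![20, 21, 22]]

/-- The permutohedron of order 4 on the vertex set `Fin 24`. -/
def permutohedron : SimpleGraph (Fin 24) where
  Adj a b := ∃ i, neighbor a i = b
  symm := ⟨by decide +kernel⟩
  loopless := ⟨by decide +kernel⟩

instance : DecidableRel permutohedron.Adj := fun a b =>
  inferInstanceAs (Decidable (∃ i, neighbor a i = b))

/-- The distance to the vertex opposite to `0`. -/
def colength : Fin 24 → ℕ :=
  ![6, 5, 5, 5, 4, 4, 4, 4, 4, 3, 3, 3, 3, 3, 3, 2, 2, 2, 2, 2, 1, 1, 1, 0]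

lemma exists_walk_length_eq_colength (v : Fin 24) :
    ∃ q : permutohedron.Walk 23 v, q.length = colength v := by
  have hstep : ∀ v : Fin 24, v ≠ 23 → ∃ u, permutohedron.Adj u v ∧ colength u + 1 = colength v := by
    decide +kernel
  induction hn : colength v generalizing v with
  | zero =>
    have : ∀ v : Fin 24, colength v = 0 → v = 23 := by decide +kernel
    obtain rfl := this v hn
    exact ⟨.nil, rfl⟩
  | succ n ih =>
    obtain ⟨u, hu, huv⟩ := hstep v (by rintro rfl; simp [colength] at hn)
    obtain ⟨q, hq⟩ := ih u (by omega)
    exact ⟨q.concat hu, by simp [hq]⟩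

/-- Reduced words for the permutations of `{1,2,3,4}`. -/
def reducedWord : Fin 24 → List (Fin 3) :=
  ![[], [0], [1], [2], [0, 1], [0, 2], [1, 0], [1, 2], [2, 1], [0, 1, 0], [0, 1, 2], [0, 2, 1],
    [1, 0, 2], [1, 2, 1], [2, 1, 0], [0, 1, 0, 2], [0, 1, 2, 1], [0, 2, 1, 0], [1, 0, 2, 1],
    [1, 2, 1, 0], [0, 1, 0, 2, 1], [0, 1, 2, 1, 0], [1, 0, 2, 1, 0], [0, 1, 0, 2, 1, 0]]

/-- The permutation corresponding to a vertex of `permutohedron`. -/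
def toPerm (a : Fin 24) : Equiv.Perm (Fin 4) :=
  ((reducedWord a).map fun i => Equiv.swap i.castSucc i.succ).prod

lemma toPerm_neighbor : ∀ a i,
    toPerm (neighbor a i) = toPerm a * Equiv.swap i.castSucc i.succ := by
  decide +kernel

lemma toPerm_bijective : Function.Bijective toPerm :=
  (Fintype.bijective_iff_injective_and_card _).2 ⟨by
    have : ∀ a b, toPerm a = toPerm b → a = b := by decide +kernel
    exact this, by decide +kernel⟩

lemma bruhatB4_adj_mul_swap (σ : Equiv.Perm (Fin 4)) (i : Fin 3) :
    bruhatB4.Adj σ (σ * Equiv.swap i.castSucc i.succ) := by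
  refine (SimpleGraph.fromRel_adj _ _ _).2 ⟨?_, .inl ⟨i, rfl⟩⟩
  simp [Fin.ext_iff]

lemma exists_eq_mul_swap_of_adj {σ τ : Equiv.Perm (Fin 4)} (h : bruhatB4.Adj σ τ) :
    ∃ i : Fin 3, τ = σ * Equiv.swap i.castSucc i.succ := by
  obtain ⟨-, h | ⟨i, hi⟩⟩ := (SimpleGraph.fromRel_adj _ _ _).1 h
  · exact h
  · exact ⟨i, by simp [hi, mul_assoc]⟩

/-- The numbering of the permutations that starts at a given root. -/
noncomputable def numbering (r : Equiv.Perm (Fin 4)) : Fin 24 ≃ Equiv.Perm (Fin 4) :=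
  (Equiv.ofBijective toPerm toPerm_bijective).trans (Equiv.mulLeft r)

lemma numbering_apply (r : Equiv.Perm (Fin 4)) (a : Fin 24) : numbering r a = r * toPerm a := rfl

lemma numbering_adj (r : Equiv.Perm (Fin 4)) (a b : Fin 24) (h : permutohedron.Adj a b) :
    bruhatB4.Adj (numbering r a) (numbering r b) := by
  obtain ⟨i, rfl⟩ := h
  rw [numbering_apply, numbering_apply, toPerm_neighbor, ← mul_assoc]
  exact bruhatB4_adj_mul_swap _ i

lemma solvable_of_sum_eq {p : Fin 24 → ℕ} (hsum : ∑ v, p v = 64) :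
    PebblingSolvable permutohedron 0 p := by
  by_contra hp
  have h0 : p 0 = 0 := eq_zero_of_not_solvable hp
  have bound : ∀ (w : Fin 24 → ℕ) (F : Finset (Fin 24)),
      (∀ v, 0 < w v →
        ∃ u, permutohedron.Adj v u ∧ (u = 0 ∨ u ∉ F ∧ 2 * w v ≤ w u)) →
      (∀ f ∈ F, f ≠ 23 ∧ 2 ^ colength f * w 23 ≤ w f) → ∑ f ∈ F, 2 ^ colength f ≤ p 23 →
      ∑ v, w v * p v ≤ ∑ v ∈ Fᶜ, w v :=
    fun w F hw hF hs =>
      weight_le_of_source hw (fun f _ => exists_walk_length_eq_colength f) hF hs hp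
  have cover : ∀ (w : Fin 24 → ℕ) (k : ℕ),
      (∀ v, 8 ≤ w v + (Pi.single 0 8 + Pi.single 23 k : Fin 24 → ℕ) v) →
      8 * 64 ≤ ∑ v, w v * p v + k * p 23 := by
    intro w k hw
    calc 8 * 64 = ∑ v, 8 * p v := by rw [← Finset.mul_sum, hsum]
      _ ≤ ∑ v, (w v + (Pi.single 0 8 + Pi.single 23 k : Fin 24 → ℕ) v) * p v :=
        Finset.sum_le_sum fun v _ => Nat.mul_le_mul_right _ (hw v)
      _ = ∑ v, w v * p v + k * p 23 := by
        simp [add_mul, Finset.sum_add_distrib, Pi.single_apply, h0]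
  rcases lt_or_ge (p 23) 12 with hlt | hge
  · let w₁ : Fin 24 → ℕ :=
      ![0, 0, 32, 0, 0, 0, 16, 0, 0, 8, 0, 0, 8, 0, 0, 0, 0, 0, 4, 0, 2, 0, 2, 1]
    let w₂ : Fin 24 → ℕ :=
      ![0, 0, 0, 32, 0, 0, 0, 0, 16, 0, 0, 0, 0, 8, 8, 0, 0, 4, 0, 4, 0, 2, 2, 1]
    let w₃ : Fin 24 → ℕ :=
      ![0, 32, 0, 0, 16, 16, 0, 0, 0, 0, 8, 8, 0, 0, 0, 4, 4, 4, 0, 0, 2, 2, 0, 1]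
    let w₄ : Fin 24 → ℕ :=
      ![0, 0, 32, 0, 0, 0, 0, 16, 0, 0, 0, 0, 8, 0, 0, 0, 0, 0, 4, 0, 2, 0, 2, 1]
    have h₁ := bound w₁ ∅ (by decide +kernel) (by simp) (by simp)
    have h₂ := bound w₂ ∅ (by decide +kernel) (by simp) (by simp)
    have h₃ := bound w₃ ∅ (by decide +kernel) (by simp) (by simp)
    have h₄ := bound w₄ ∅ (by decide +kernel) (by simp) (by simp)
    have h := cover (w₁ + 2 • w₂ + 2 • w₃ + w₄) 2 (by decide +kernel)
    simp only [Pi.add_apply, Pi.smul_apply, smul_eq_mul, add_mul, mul_assoc,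
      Finset.sum_add_distrib, ← Finset.mul_sum] at h
    have e₁ : ∑ v ∈ ∅ᶜ, w₁ v = 73 := by decide +kernel
    have e₂ : ∑ v ∈ ∅ᶜ, w₂ v = 77 := by decide +kernel
    have e₃ : ∑ v ∈ ∅ᶜ, w₃ v = 97 := by decide +kernel
    have e₄ : ∑ v ∈ ∅ᶜ, w₄ v = 65 := by decide +kernel
    omega
  · let w₁ : Fin 24 → ℕ :=
      ![0, 0, 32, 0, 0, 0, 16, 0, 0, 8, 0, 0, 8, 0, 0, 0, 0, 0, 4, 0, 2, 0, 2, 1]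
    let w₂ : Fin 24 → ℕ :=
      ![0, 0, 0, 32, 0, 0, 0, 0, 16, 0, 0, 0, 0, 8, 8, 0, 0, 4, 0, 4, 0, 2, 0, 1]
    let w₃ : Fin 24 → ℕ :=
      ![0, 32, 0, 0, 16, 0, 0, 0, 0, 8, 8, 0, 0, 0, 0, 4, 4, 0, 0, 0, 0, 2, 0, 1]
    let w₄ : Fin 24 → ℕ :=
      ![0, 32, 0, 0, 16, 0, 0, 0, 0, 0, 8, 0, 0, 0, 0, 4, 4, 0, 0, 0, 2, 2, 0, 1]
    let w₅ : Fin 24 → ℕ :=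
      ![0, 0, 32, 0, 0, 0, 0, 16, 0, 0, 0, 0, 0, 8, 0, 0, 0, 0, 0, 4, 0, 0, 2, 1]
    let w₆ : Fin 24 → ℕ :=
      ![0, 32, 0, 0, 0, 16, 0, 0, 0, 0, 0, 8, 0, 0, 0, 0, 0, 4, 0, 0, 0, 2, 0, 1]
    have h₁ := bound w₁ {9, 20} (by decide +kernel) (by decide +kernel) (le_trans (by decide) hge)
    have h₂ := bound w₂ {13, 19} (by decide +kernel) (by decide +kernel) (le_trans (by decide) hge)
    have h₃ := bound w₃ {9, 15} (by decide +kernel) (by decide +kernel) (le_trans (by decide) hge)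
    have h₄ := bound w₄ {20} (by decide +kernel) (by decide +kernel) (le_trans (by decide) hge)
    have h₅ := bound w₅ ∅ (by decide +kernel) (by simp) (by simp)
    have h₆ := bound w₆ ∅ (by decide +kernel) (by simp) (by simp)
    have h := cover (3 • w₁ + w₂ + w₃ + w₄ + w₅ + w₆) 0 (by decide +kernel)
    simp only [Pi.add_apply, Pi.smul_apply, smul_eq_mul, add_mul, mul_assoc,
      Finset.sum_add_distrib, ← Finset.mul_sum] at h
    have e₁ : ∑ v ∈ {9, 20}ᶜ, w₁ v = 63 := by decide +kernel
    have e₂ : ∑ v ∈ {13, 19}ᶜ, w₂ v = 63 := by decide +kernel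
    have e₃ : ∑ v ∈ {9, 15}ᶜ, w₃ v = 63 := by decide +kernel
    have e₄ : ∑ v ∈ {20}ᶜ, w₄ v = 67 := by decide +kernel
    have e₅ : ∑ v ∈ ∅ᶜ, w₅ v = 63 := by decide +kernel
    have e₆ : ∑ v ∈ ∅ᶜ, w₆ v = 63 := by decide +kernel
    omega

/-- The number of inversions of a permutation of `{1,2,3,4}`. -/
def inversionCount (σ : Equiv.Perm (Fin 4)) : ℕ :=
  (Finset.univ.filter fun x : Fin 4 × Fin 4 => x.1 < x.2 ∧ σ x.2 < σ x.1).card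

lemma not_solvable_single {k : ℕ} (hk : k < 64) :
    ¬ PebblingSolvable bruhatB4 1 (Pi.single Fin.revPerm k) := by
  have hw : ∀ (σ : Equiv.Perm (Fin 4)) (i : Fin 3),
      2 ^ (6 - inversionCount (σ * Equiv.swap i.castSucc i.succ)) ≤
        2 * 2 ^ (6 - inversionCount σ) := by
    decide +kernel
  refine not_solvable_of_weight (w := fun σ => 2 ^ (6 - inversionCount σ)) ?_ ?_
  · intro σ τ h
    obtain ⟨i, rfl⟩ := exists_eq_mul_swap_of_adj h
    exact hw σ i
  · have h1 : inversionCount 1 = 0 := by decide +kernel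
    have h2 : inversionCount Fin.revPerm = 6 := by decide +kernel
    simpa [Pi.single_apply, h1, h2] using hk

end Pebbling

/-- The pebbling number of the Bruhat graph of order 4 is 64. -/
theorem pebblingNumber_B4 : pebblingNumber bruhatB4 = 64 := by
  have hmem : 64 ∈ {k : ℕ | ∀ (r : Equiv.Perm (Fin 4)) (p : Equiv.Perm (Fin 4) → ℕ),
      (∑ v, p v) = k → PebblingSolvable bruhatB4 r p} := by
    intro r p hp
    have hr : Pebbling.numbering r 0 = r := by
      simp [Pebbling.numbering_apply, Pebbling.toPerm, Pebbling.reducedWord]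
    rw [← hr]
    refine Pebbling.solvable_of_equiv _ (Pebbling.numbering_adj r) (Pebbling.solvable_of_sum_eq ?_)
    rw [← hp]
    exact Equiv.sum_comp (Pebbling.numbering r) p
  refine le_antisymm (Nat.sInf_le hmem) (le_csInf ⟨64, hmem⟩ fun k hk => ?_)
  by_contra! hlt
  exact Pebbling.not_solvable_single hlt (hk 1 _ (by simp))
end

section
/- If G is a finite connected simple Class 0 graph on n vertices with diameter at least 3 and minimum degree δ(G) = 2, then the number of edges of G satisfies e(G) ≥ (5/3)n − 11/3. -/
/-- In a Class 0 graph every configuration whose size is the number of vertices is solvable. -/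
lemma Class0.solvable {V : Type*} [Fintype V] [Nonempty V] {G : SimpleGraph V} (h : Class0 G)
    (r : V) (p : V → ℕ) (hp : ∑ v, p v = Fintype.card V) : PebblingSolvable G r p := by
  have hne : {k : ℕ | ∀ (r : V) (p : V → ℕ), (∑ v, p v) = k →
      PebblingSolvable G r p}.Nonempty := by
    apply Nat.nonempty_of_pos_sInf
    change 0 < pebblingNumber G
    rw [h]
    exact Fintype.card_pos
  have hmem := Nat.sInf_mem hne
  change pebblingNumber G ∈ _ at hmem
  rw [h] at hmem
  exact hmem r p hp

/-- A property preserved by pebbling moves that forces the root to be empty rules out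
solvability. -/
lemma not_pebblingSolvable_of_invariant {V : Type*} {G : SimpleGraph V} {r : V} {p : V → ℕ}
    (I : (V → ℕ) → Prop) (hp : I p) (hI : ∀ q q', I q → PebblingMove G q q' → I q')
    (hr : ∀ q, I q → q r = 0) : ¬ PebblingSolvable G r p := by
  rintro ⟨q, hq, h1⟩
  have hq' : I q := by
    clear h1
    induction hq with
    | refl => exact hp
    | tail _ hm ih => exact hI _ _ ih hm
  have := hr q hq'
  omega

section Pebbling

variable {V : Type*} [Fintype V] [DecidableEq V] {G : SimpleGraph V}

/-- A Class 0 graph has no cut vertex. -/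
lemma Class0.not_separating [Nonempty V] (h : Class0 G) {a r s : V} {C : Set V} (hs : s ∈ C)
    (ha : a ∉ C) (hr : r ∉ C) (hra : r ≠ a)
    (hC : ∀ x ∈ C, ∀ y, G.Adj x y → y ∈ C ∨ y = a) : False := by
  have hsa : s ≠ a := fun e => ha (e ▸ hs)
  have hsr : s ≠ r := fun e => hr (e ▸ hs)
  let p : V → ℕ := fun x => if x = s then 3 else if x = a then 0 else if x = r then 0 else 1
  refine not_pebblingSolvable_of_invariant (r := r) (p := p)
    (fun q => q r = 0 ∧ ((∀ x, q x ≤ 1) ∨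
      (q a = 0 ∧ ∃ z ∈ C, q z ≤ 3 ∧ ∀ x, x ≠ z → q x ≤ 1))) ?_ ?_ (fun q hq => hq.1)
    (h.solvable r p ?_)
  · refine ⟨by simp [p, hsr.symm], .inr ⟨by simp [p, hsa.symm], s, hs, by simp [p], ?_⟩⟩
    intro x hx
    simp only [p, hx, if_false]
    split_ifs <;> omega
  · rintro q q' ⟨hq0, hq⟩ ⟨u, w, huw, hu, hqu, hqw, hqx⟩
    rcases hq with hq | ⟨hqa, z, hz, hz3, hq⟩
    · have := hq u
      omega
    · have huz : u = z := by
        by_contra hne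
        have := hq u hne
        omega
      subst huz
      have hwu : w ≠ u := huw.ne.symm
      have hrw : r ≠ w := by
        rintro rfl
        rcases hC u hz _ huw with h | h
        · exact hr h
        · exact hra h
      have hru : r ≠ u := fun e => hr (e ▸ hz)
      refine ⟨by rw [hqx r hru hrw, hq0], ?_⟩
      rcases hC u hz _ huw with hwC | rfl
      · refine .inr ⟨?_, w, hwC, ?_, ?_⟩
        · rw [hqx a (fun e => ha (e ▸ hz)) (fun e => ha (e ▸ hwC)), hqa]
        · have := hq w hwu
          omega
        · intro x hx
          by_cases hxu : x = u
          · subst hxu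
            omega
          · rw [hqx x hxu hx]
            exact hq x hxu
      · left
        intro x
        by_cases hxu : x = u
        · subst hxu
          omega
        by_cases hxw : x = w
        · subst hxw
          omega
        rw [hqx x hxu hxw]
        exact hq x hxu
  · have hpt : ∀ x, p x + (if x = a then 1 else 0) + (if x = r then 1 else 0)
        = 1 + if x = s then 2 else 0 := by
      intro x
      simp only [p]
      by_cases h1 : x = s
      · subst h1
        simp [hsa, hsr]
      · by_cases h2 : x = a
        · subst h2
          simp [hra.symm, h1]
        · simp only [h1, h2, if_false]
          split_ifs <;> rfl
    have hsum := Finset.sum_congr (rfl : (Finset.univ : Finset V) = Finset.univ)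
      (fun x _ => hpt x)
    simp only [Finset.sum_add_distrib, Finset.sum_ite_eq', Finset.mem_univ, if_true,
      Finset.sum_const, Finset.card_univ, smul_eq_mul] at hsum
    omega

/-- In a Class 0 graph, the degrees of two vertices at distance at least three add up to at
least six. -/
lemma Class0.six_le_degree_add_degree [DecidableRel G.Adj] [Nonempty V] (h : Class0 G) {r v : V}
    (hne : r ≠ v) (hadj : ¬ G.Adj r v) (hcomm : ∀ x, G.Adj r x → ¬ G.Adj v x) :
    6 ≤ G.degree r + G.degree v := by
  by_contra! hlt
  let c : V → ℕ := fun x => if x = r ∨ G.Adj r x then 0 else 1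
  let p : V → ℕ := fun x => if x = v then G.degree r + G.degree v + 2 else
    if G.Adj v x then 0 else c x
  let σ : (V → ℕ) → ℕ := fun q => ∑ x ∈ G.neighborFinset v, q x
  have hvr : ¬ G.Adj v r := fun e => hadj e.symm
  have hc1 : ∀ x, c x ≤ 1 := fun x => by simp only [c]; split_ifs <;> omega
  have hσ : ∀ (q q' : V → ℕ), (∀ x, G.Adj v x → q' x = q x) → σ q' = σ q := fun q q' hqq =>
    Finset.sum_congr rfl fun x hx => hqq x (by simpa using hx)
  have hσ₁ : ∀ (q q' : V → ℕ) (y : V), G.Adj v y → (∀ x, G.Adj v x → x ≠ y → q' x = q x) →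
      σ q' + q y = σ q + q' y := by
    intro q q' y hy hqq
    have hy' : y ∈ G.neighborFinset v := by simpa using hy
    have e1 := Finset.sum_erase_add _ q hy'
    have e2 := Finset.sum_erase_add _ q' hy'
    have e3 : ∑ x ∈ (G.neighborFinset v).erase y, q' x = ∑ x ∈ (G.neighborFinset v).erase y, q x :=
      Finset.sum_congr rfl fun x hx => by
        simp only [Finset.mem_erase, SimpleGraph.mem_neighborFinset] at hx
        exact hqq x hx.2 hx.1
    simp only [σ]
    omega
  have hle : ∀ (q : V → ℕ) (y : V), G.Adj v y → q y ≤ σ q := fun q y hy =>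
    Finset.single_le_sum (f := q) (fun _ _ => Nat.zero_le _) (by simpa using hy)
  refine not_pebblingSolvable_of_invariant (r := r) (p := p)
    (fun q => (q v + 2 * σ q ≤ 7 ∧ ∀ x, x ≠ v → ¬ G.Adj v x → q x ≤ c x) ∨
      (q v + 2 * σ q ≤ 3 ∧ ∃ z, z ≠ v ∧ ¬ G.Adj v z ∧ z ≠ r ∧ q z ≤ c z + 1 ∧
        ∀ x, x ≠ v → ¬ G.Adj v x → x ≠ z → q x ≤ c x)) ?_ ?_ ?_ (h.solvable r p ?_)
  · left
    have h0 : σ p = 0 := Finset.sum_eq_zero fun x hx => by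
      have hx : G.Adj v x := by simpa using hx
      simp [p, hx, hx.ne.symm]
    refine ⟨?_, fun x hx hx' => by simp [p, hx, hx']⟩
    rw [h0]
    simp only [p, if_true]
    omega
  · rintro q q' hq ⟨u, w, huw, hu, hqu, hqw, hqx⟩
    have hwu : w ≠ u := huw.ne.symm
    by_cases huv : u = v
    · subst huv
      have hs := hσ₁ q q' w huw fun x hx hxw => hqx x hx.ne.symm hxw
      have hout : ∀ x, x ≠ u → ¬ G.Adj u x → q' x = q x := fun x hx hx' =>
        hqx x hx fun e => hx' (e ▸ huw)
      rcases hq with ⟨hq7, hq⟩ | ⟨hq3, z, hzv, hzN, hzr, hz, hq⟩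
      · exact .inl ⟨by omega, fun x hx hx' => (hout x hx hx').trans_le (hq x hx hx')⟩
      · exact .inr ⟨by omega, z, hzv, hzN, hzr, (hout z hzv hzN).trans_le hz,
          fun x hx hx' hxz => (hout x hx hx').trans_le (hq x hx hx' hxz)⟩
    by_cases huN : G.Adj v u
    · have hσu := hle q u huN
      rcases hq with ⟨hq7, hq⟩ | ⟨hq3, _⟩
      swap
      · omega
      by_cases hwv : w = v
      · subst hwv
        have hs := hσ₁ q q' u huN fun x hx hxu => hqx x hxu hx.ne.symm
        exact .inl ⟨by omega, fun x hx hx' =>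
          (hqx x (fun e => hx' (e ▸ huN)) hx).trans_le (hq x hx hx')⟩
      have hv' : q' v = q v := hqx v (Ne.symm huv) (Ne.symm hwv)
      by_cases hwN : G.Adj v w
      · have hs₁ := hσ₁ q (Function.update q u (q u - 2)) u huN
          fun x _ hxu => Function.update_of_ne hxu _ _
        have hs₂ := hσ₁ (Function.update q u (q u - 2)) q' w hwN fun x _ hxw => by
          by_cases hxu : x = u
          · subst hxu
            simp [hqu]
          · rw [Function.update_of_ne hxu, hqx x hxu hxw]
        rw [Function.update_self] at hs₁
        rw [Function.update_of_ne hwu] at hs₂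
        exact .inl ⟨by omega, fun x hx hx' =>
          (hqx x (fun e => hx' (e ▸ huN)) (fun e => hx' (e ▸ hwN))).trans_le (hq x hx hx')⟩
      · have hs := hσ₁ q q' u huN fun x hx hxu => hqx x hxu fun e => hwN (e ▸ hx)
        refine .inr ⟨by omega, w, hwv, hwN, ?_, ?_, ?_⟩
        · rintro rfl
          exact hcomm u huw.symm huN
        · have := hq w hwv hwN
          omega
        · exact fun x hx hx' hxw =>
            (hqx x (fun e => hx' (e ▸ huN)) hxw).trans_le (hq x hx hx')
    · rcases hq with ⟨hq7, hq⟩ | ⟨hq3, z, hzv, hzN, hzr, hz, hq⟩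
      · have := hq u huv huN
        have := hc1 u
        omega
      have huz : u = z := by
        by_contra hne
        have := hq u huv huN hne
        have := hc1 u
        omega
      subst huz
      have hcu : c u = 1 := by
        have := hc1 u
        omega
      have hru : ¬ G.Adj r u := fun e => by simp [c, e] at hcu
      have hwv : w ≠ v := by
        rintro rfl
        exact huN huw.symm
      have hwr : w ≠ r := by
        rintro rfl
        exact hru huw.symm
      have hv' : q' v = q v := hqx v (Ne.symm huv) (Ne.symm hwv)
      have hu' : q' u ≤ c u := by omega
      by_cases hwN : G.Adj v w
      · have hs := hσ₁ q q' w hwN fun x hx hxw => hqx x (fun e => huN (e ▸ hx)) hxw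
        refine .inl ⟨by omega, fun x hx hx' => ?_⟩
        by_cases hxu : x = u
        · exact hxu ▸ hu'
        · exact (hqx x hxu fun e => hx' (e ▸ hwN)).trans_le (hq x hx hx' hxu)
      · have hs := hσ q q' fun x hx => hqx x (fun e => huN (e ▸ hx)) (fun e => hwN (e ▸ hx))
        refine .inr ⟨by omega, w, hwv, hwN, hwr, ?_, fun x hx hx' hxw => ?_⟩
        · have := hq w hwv hwN hwu
          omega
        · by_cases hxu : x = u
          · exact hxu ▸ hu'
          · exact (hqx x hxu hxw).trans_le (hq x hx hx' hxu)
  · have hcr : c r = 0 := by simp [c]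
    rintro q (⟨-, hq⟩ | ⟨-, z, -, -, hzr, -, hq⟩)
    · have := hq r hne hvr
      omega
    · have := hq r hne hvr hzr.symm
      omega
  · have hpt : ∀ x, p x + ((if G.Adj v x then 1 else 0) + (if G.Adj r x then 1 else 0) +
        (if x = r then 1 else 0)) = 1 + if x = v then G.degree r + G.degree v + 1 else 0 := by
      intro x
      simp only [p, c]
      by_cases h1 : x = v
      · subst h1
        simp [hadj, hne.symm]
        omega
      by_cases h2 : x = r
      · subst h2
        simp [hvr, h1]
      by_cases h3 : G.Adj r x
      · simp [h1, h2, h3, hcomm x h3]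
      · by_cases h4 : G.Adj v x <;> simp [h1, h2, h3, h4]
    have hsum := Finset.sum_congr (rfl : (Finset.univ : Finset V) = Finset.univ)
      (fun x _ => hpt x)
    have hdeg : ∀ y, ∑ x, (if G.Adj y x then 1 else 0) = G.degree y := fun y => by
      rw [← G.card_neighborFinset_eq_degree, G.neighborFinset_eq_filter, Finset.card_filter]
    simp only [Finset.sum_add_distrib, Finset.sum_ite_eq', Finset.mem_univ, if_true,
      Finset.sum_const, Finset.card_univ, smul_eq_mul, hdeg] at hsum
    omega

/-- If adding edges from `b` to all vertices of `Z` makes `H` connected, then `H` has many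
edges. -/
lemma card_le_card_edgeFinset_add_card (H : SimpleGraph V) [DecidableRel H.Adj] (b : V)
    (Z : Finset V)
    (hK : (H ⊔ SimpleGraph.fromRel fun x y => x = b ∧ y ∈ Z).Connected) :
    Fintype.card V ≤ H.edgeFinset.card + Z.card + 1 := by
  classical
  have h1 := hK.card_vert_le_card_edgeSet_add_one
  rw [Nat.card_eq_fintype_card, Nat.card_eq_fintype_card, ← SimpleGraph.edgeFinset_card] at h1
  refine h1.trans (Nat.add_le_add_right ?_ 1)
  have hsub : (H ⊔ SimpleGraph.fromRel fun x y => x = b ∧ y ∈ Z).edgeFinset ⊆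
      H.edgeFinset ∪ Z.image (fun z => s(b, z)) := by
    intro e
    induction e with | _ x y => ?_
    simp only [SimpleGraph.mem_edgeFinset, SimpleGraph.mem_edgeSet, SimpleGraph.sup_adj,
      SimpleGraph.fromRel_adj, Finset.mem_union, Finset.mem_image]
    rintro (hxy | ⟨-, ⟨rfl, hy⟩ | ⟨rfl, hx⟩⟩)
    · exact .inl hxy
    · exact .inr ⟨y, hy, rfl⟩
    · exact .inr ⟨x, hx, Sym2.eq_swap⟩
  exact (Finset.card_le_card hsub).trans ((Finset.card_union_le _ _).trans
    (Nat.add_le_add_left Finset.card_image_le _))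

/-- Two vertices different from `a` are joined in a Class 0 graph by a path avoiding `a`, so any
reflexive transitive relation containing all edges that avoid `a` relates them. -/
lemma Class0.rel_of_ne [Nonempty V] (h : Class0 G) {a : V} {R : V → V → Prop}
    (hR : ∀ x y, x ≠ a → y ≠ a → G.Adj x y → R x y) (hrefl : ∀ x, R x x)
    (htrans : ∀ x y z, R x y → R y z → R x z) {x y : V} (hx : x ≠ a) (hy : y ≠ a) : R x y := by
  by_contra hxy
  refine h.not_separating (a := a) (r := y) (s := x) (C := {z | z ≠ a ∧ R x z})
    ⟨hx, hrefl x⟩ (fun e => e.1 rfl) (fun e => hxy e.2) hy ?_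
  rintro z ⟨hza, hz⟩ w hzw
  by_cases hwa : w = a
  · exact .inr hwa
  · exact .inl ⟨hwa, htrans _ _ _ hz (hR z w hza hwa hzw)⟩

/-- The subgraph of `G` consisting of the edges inside `U`. -/
def edgesWithin (G : SimpleGraph V) (U : Finset V) : SimpleGraph V where
  Adj x y := G.Adj x y ∧ x ∈ U ∧ y ∈ U
  symm := ⟨fun _ _ h => ⟨h.1.symm, h.2.2, h.2.1⟩⟩
  loopless := ⟨fun _ h => h.1.ne rfl⟩

instance [DecidableRel G.Adj] (U : Finset V) : DecidableRel (edgesWithin G U).Adj :=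
  fun x y => inferInstanceAs (Decidable (G.Adj x y ∧ x ∈ U ∧ y ∈ U))

lemma degree_edgesWithin_of_notMem [DecidableRel G.Adj] {U : Finset V} {v : V} (hv : v ∉ U) :
    (edgesWithin G U).degree v = 0 := by
  rw [← SimpleGraph.card_neighborFinset_eq_degree, Finset.card_eq_zero,
    Finset.eq_empty_iff_forall_notMem]
  intro x hx
  rw [SimpleGraph.mem_neighborFinset] at hx
  exact hv hx.2.1

/-- Edges leaving `U` towards two vertices `a`, `b` outside `U` are not inside `U`. -/
lemma card_edgesWithin_add_le [DecidableRel G.Adj] {U : Finset V} {a b : V} (hab : a ≠ b)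
    (ha : a ∉ U) (hb : b ∉ U) :
    (edgesWithin G U).edgeFinset.card + ((G.neighborFinset a).erase b).card +
      ((G.neighborFinset b).erase a).card ≤ G.edgeFinset.card := by
  have hinj : ∀ c : V, Function.Injective (fun x : V => s(c, x)) := fun c x y hxy =>
    Sym2.congr_right.1 hxy
  rw [← Finset.card_image_of_injective ((G.neighborFinset a).erase b) (hinj a),
    ← Finset.card_image_of_injective ((G.neighborFinset b).erase a) (hinj b),
    ← Finset.card_union_of_disjoint, ← Finset.card_union_of_disjoint]
  · refine Finset.card_le_card fun e => ?_
    simp only [Finset.mem_union, Finset.mem_image, Finset.mem_erase,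
      SimpleGraph.mem_neighborFinset, SimpleGraph.mem_edgeFinset]
    rintro ((he | ⟨x, hx, rfl⟩) | ⟨x, hx, rfl⟩)
    · induction e with | _ x y => exact he.1
    · exact hx.2
    · exact hx.2
  · rw [Finset.disjoint_left]
    intro e he he'
    obtain ⟨x, hx, rfl⟩ := Finset.mem_image.1 he'
    simp only [Finset.mem_union, Finset.mem_image, Finset.mem_erase,
      SimpleGraph.mem_neighborFinset, SimpleGraph.mem_edgeFinset] at he hx
    rcases he with he | ⟨y, hy, he⟩
    · exact hb he.2.1
    · rcases Sym2.eq_iff.1 he with ⟨h1, -⟩ | ⟨h1, -⟩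
      · exact hab h1
      · exact hx.1 h1.symm
  · rw [Finset.disjoint_left]
    intro e he he'
    obtain ⟨x, hx, rfl⟩ := Finset.mem_image.1 he'
    rw [SimpleGraph.mem_edgeFinset] at he
    exact ha he.2.1

/-- The edge bound, in integers, around a vertex `r` of degree two. -/
lemma Class0.five_mul_card_le [DecidableRel G.Adj] (hG : G.Connected) (h : Class0 G)
    (hmin : ∀ v : V, 2 ≤ G.degree v) {r : V} (hr : G.degree r = 2) :
    5 * Fintype.card V ≤ 3 * G.edgeFinset.card + 10 := by
  have := hG.nonempty
  obtain ⟨a, b, hab, hN⟩ := Finset.card_eq_two.1 hr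
  have hrN : ∀ x, G.Adj r x ↔ x = a ∨ x = b := fun x => by
    rw [← SimpleGraph.mem_neighborFinset, hN]
    simp
  have hra : G.Adj r a := (hrN a).2 (.inl rfl)
  have hrb : G.Adj r b := (hrN b).2 (.inr rfl)
  set U : Finset V := ({r, a, b} : Finset V)ᶜ with hU
  have hmemU : ∀ x, x ∈ U ↔ x ≠ r ∧ x ≠ a ∧ x ≠ b := fun x => by simp [hU]
  have hcardU : U.card + 3 = Fintype.card V := by
    rw [← Finset.card_compl_add_card ({r, a, b} : Finset V),
      Finset.card_eq_three.2 ⟨r, a, b, hra.ne, hrb.ne, hab, rfl⟩]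
  set H := edgesWithin G U
  have hHadj : ∀ x y, G.Adj x y → x ∈ U → y ∈ U → H.Adj x y := fun x y h1 h2 h3 => ⟨h1, h2, h3⟩
  have haU : a ∉ U := by simp [hmemU]
  have hbU : b ∉ U := by simp [hmemU]
  have hrU : r ∉ U := by simp [hmemU]
  -- Degrees of vertices of `U` inside `U`.
  have hdegU : ∀ v ∈ U, G.degree v =
      H.degree v + (if G.Adj a v then 1 else 0) + (if G.Adj b v then 1 else 0) := by
    intro v hv
    have hvr : ¬ G.Adj r v := fun e => by
      rw [hrN] at e
      have := (hmemU v).1 hv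
      tauto
    have hsum : ∀ (K : SimpleGraph V) [DecidableRel K.Adj],
        K.degree v = ∑ x, if K.Adj v x then 1 else 0 := fun K _ => by
      rw [← K.card_neighborFinset_eq_degree, K.neighborFinset_eq_filter, Finset.card_filter]
    have hpt : ∀ x, (if G.Adj v x then 1 else 0) = (if H.Adj v x then 1 else 0) +
        (if x = a then (if G.Adj a v then 1 else 0) else 0) +
        (if x = b then (if G.Adj b v then 1 else 0) else 0) := by
      intro x
      have hHx : H.Adj v x ↔ G.Adj v x ∧ x ∈ U := ⟨fun e => ⟨e.1, e.2.2⟩, fun e => ⟨e.1, hv, e.2⟩⟩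
      simp only [hHx, hmemU]
      by_cases h1 : x = a
      · subst h1
        simp [hab, G.adj_comm]
      by_cases h2 : x = b
      · subst h2
        simp [h1, G.adj_comm]
      by_cases h3 : x = r
      · subst h3
        simp [h1, h2, G.adj_comm v, hvr]
      · simp [h1, h2, h3]
    rw [hsum G, hsum H, Finset.sum_congr rfl fun x _ => hpt x]
    simp [Finset.sum_add_distrib]
  have hfar : ∀ v ∈ U, ¬ G.Adj a v → ¬ G.Adj b v → 4 ≤ H.degree v := by
    intro v hv hav hbv
    have hv' := (hmemU v).1 hv
    have h6 := h.six_le_degree_add_degree (r := r) (v := v) hv'.1.symm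
      (fun e => by rw [hrN] at e; tauto)
      (fun x hx hvx => by
        rcases (hrN x).1 hx with rfl | rfl
        · exact hav hvx.symm
        · exact hbv hvx.symm)
    have := hdegU v hv
    simp only [hav, hbv, if_false] at this
    omega
  set Q : Finset V := U.filter fun v =>
    (G.Adj a v ∧ G.Adj b v) ∨ ((G.Adj a v ∨ G.Adj b v) ∧ 2 ≤ H.degree v) with hQ
  -- Adding few edges at `b` to `H` gives a connected graph.
  have hconn : Fintype.card V ≤ H.edgeFinset.card + Q.card + 4 := by
    suffices ∃ p₀ : V, (H ⊔ SimpleGraph.fromRel fun x y =>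
        x = b ∧ y ∈ insert p₀ (insert r (insert a Q))).Connected by
      obtain ⟨p₀, hp₀⟩ := this
      have h1 := card_le_card_edgeFinset_add_card H b _ hp₀
      have h2 := Finset.card_insert_le p₀ (insert r (insert a Q))
      have h3 := Finset.card_insert_le r (insert a Q)
      have h4 := Finset.card_insert_le a Q
      omega
    have hHK : ∀ (Z : Finset V) (x y : V), G.Adj x y → x ∈ U → y ∈ U →
        (H ⊔ SimpleGraph.fromRel fun x y => x = b ∧ y ∈ Z).Reachable x y := fun Z x y h1 h2 h3 =>
      SimpleGraph.Adj.reachable (.inl (hHadj x y h1 h2 h3))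
    have hZK : ∀ (Z : Finset V) (y : V), y ∈ Z →
        (H ⊔ SimpleGraph.fromRel fun x y => x = b ∧ y ∈ Z).Reachable y b := fun Z y hy => by
      by_cases hyb : y = b
      · exact hyb ▸ .refl _
      · exact SimpleGraph.Adj.reachable (.inr ⟨hyb, .inr ⟨rfl, hy⟩⟩)
    by_cases hcase : ∃ p ∈ U, ∃ q ∈ U, p ∉ Q ∧ q ∉ Q ∧ G.Adj a p ∧ G.Adj b q
    · obtain ⟨p, hpU, q, hqU, hpQ, hqQ, hap, hbq⟩ := hcase
      refine ⟨p, ?_⟩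
      set Z := insert p (insert r (insert a Q)) with hZ
      set K := H ⊔ SimpleGraph.fromRel fun x y => x = b ∧ y ∈ Z with hK
      have hlink : ∀ x ∈ U, ∀ y ∈ U, x ∉ Q → y ∉ Q → G.Adj a x → G.Adj b y → K.Reachable x y := by
        intro x hx y hy hxQ hyQ hax hby
        have hbx : ¬ G.Adj b x := fun e => hxQ (by simp [hQ, hx, hax, e])
        have hay : ¬ G.Adj a y := fun e => hyQ (by simp [hQ, hy, hby, e])
        have hdx : H.degree x < 2 := by
          by_contra! e
          exact hxQ (by simp [hQ, hx, hax, e])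
        have hdy : H.degree y < 2 := by
          by_contra! e
          exact hyQ (by simp [hQ, hy, hby, e])
        have e1 := hdegU x hx
        have e2 := hdegU y hy
        simp only [hax, hbx, hay, hby, if_true, if_false] at e1 e2
        by_cases hxy : G.Adj x y
        · exact hHK Z x y hxy hx hy
        have hne : x ≠ y := fun e => hbx (e ▸ hby)
        have hc : ∃ z, G.Adj x z ∧ G.Adj y z := by
          by_contra! hc
          have := h.six_le_degree_add_degree hne hxy hc
          omega
        obtain ⟨z, hxz, hyz⟩ := hc
        have hzU : z ∈ U := by
          rw [hmemU]
          refine ⟨?_, ?_, ?_⟩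
          · rintro rfl
            have h1 := (hrN x).1 hxz.symm
            have h2 := (hmemU x).1 hx
            tauto
          · rintro rfl
            exact hay hyz.symm
          · rintro rfl
            exact hbx hxz.symm
        exact (hHK Z x z hxz hx hzU).trans (hHK Z z y hyz.symm hzU hy)
      have hpb : K.Reachable p b := hZK Z p (by simp [hZ])
      have hqb : K.Reachable q b := (hlink p hpU q hqU hpQ hqQ hap hbq).symm.trans hpb
      have hout : ∀ x, x ∉ U → K.Reachable x b := by
        intro x hx
        have : x = r ∨ x = a ∨ x = b := by
          rw [hmemU] at hx
          tauto
        rcases this with rfl | rfl | rfl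
        · exact hZK Z _ (by simp [hZ])
        · exact hZK Z _ (by simp [hZ])
        · exact .refl _
      have hin : ∀ x ∈ U, ∀ y ∉ U, G.Adj x y → K.Reachable x b := by
        intro x hx y hy hxy
        by_cases hxQ : x ∈ Q
        · exact hZK Z x (by simp [hZ, hxQ])
        have hyy : y = r ∨ y = a ∨ y = b := by
          rw [hmemU] at hy
          tauto
        rcases hyy with rfl | rfl | rfl
        · have h1 := (hrN x).1 hxy.symm
          have h2 := (hmemU x).1 hx
          tauto
        · exact (hlink x hx q hqU hxQ hqQ hxy.symm hbq).trans hqb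
        · exact (hlink p hpU x hx hpQ hxQ hap hxy.symm).symm.trans hpb
      have hstep : ∀ x y, G.Adj x y → K.Reachable x y := by
        intro x y hxy
        by_cases hx : x ∈ U <;> by_cases hy : y ∈ U
        · exact hHK Z x y hxy hx hy
        · exact (hin x hx y hy hxy).trans (hout y hy).symm
        · exact (hout x hx).trans (hin y hy x hx hxy.symm).symm
        · exact (hout x hx).trans (hout y hy).symm
      refine ⟨fun x y => ?_⟩
      obtain ⟨w⟩ := hG.preconnected x y
      induction w with
      | nil => exact .refl _
      | cons hxy _ ih => exact (hstep _ _ hxy).trans ih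
    · push Not at hcase
      refine ⟨r, ?_⟩
      set Z := insert r (insert r (insert a Q)) with hZ
      set K := H ⊔ SimpleGraph.fromRel fun x y => x = b ∧ y ∈ Z with hK
      have hrK : K.Reachable r b := hZK Z r (by simp [hZ])
      have haK : K.Reachable a b := hZK Z a (by simp [hZ])
      have hall : (∀ x ∈ U, G.Adj b x → x ∈ Q) ∨ (∀ x ∈ U, G.Adj a x → x ∈ Q) := by
        by_contra! hcon
        obtain ⟨⟨q, hq, hbq, hqQ⟩, p, hp, hap, hpQ⟩ := hcon
        exact hcase p hp q hq hpQ hqQ hap hbq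
      suffices ∃ c d, (c = a ∧ d = b ∨ c = b ∧ d = a) ∧ ∀ x ∈ U, G.Adj d x → x ∈ Q by
        obtain ⟨c, d, hcd, hd⟩ := this
        have hdK : K.Reachable d b := by
          rcases hcd with ⟨-, rfl⟩ | ⟨-, rfl⟩
          exacts [.refl _, haK]
        have hcK : K.Reachable c b := by
          rcases hcd with ⟨rfl, -⟩ | ⟨rfl, -⟩
          exacts [haK, .refl _]
        have hdc : d ≠ c := by
          rcases hcd with ⟨rfl, rfl⟩ | ⟨rfl, rfl⟩
          exacts [hab.symm, hab]
        have hnU : ∀ x, x ≠ c → x ∉ U → x = r ∨ x = d := by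
          intro x hxc hx
          rw [hmemU] at hx
          rcases hcd with ⟨rfl, rfl⟩ | ⟨rfl, rfl⟩ <;> tauto
        have hout : ∀ x, x ≠ c → x ∉ U → K.Reachable x b := by
          intro x hxc hx
          rcases hnU x hxc hx with rfl | rfl
          exacts [hrK, hdK]
        have hin : ∀ x ∈ U, ∀ y ∉ U, y ≠ c → G.Adj x y → K.Reachable x b := by
          intro x hx y hy hyc hxy
          rcases hnU y hyc hy with rfl | rfl
          · have h1 := (hrN x).1 hxy.symm
            have h2 := (hmemU x).1 hx
            tauto
          · exact hZK Z x (by simp [hZ, hd x hx hxy.symm])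
        have hstep : ∀ x y, x ≠ c → y ≠ c → G.Adj x y → K.Reachable x y := by
          intro x y hxc hyc hxy
          by_cases hx : x ∈ U <;> by_cases hy : y ∈ U
          · exact hHK Z x y hxy hx hy
          · exact (hin x hx y hy hyc hxy).trans (hout y hyc hy).symm
          · exact (hout x hxc hx).trans (hin y hy x hx hxc hxy.symm).symm
          · exact (hout x hxc hx).trans (hout y hyc hy).symm
        have hb : ∀ x, K.Reachable x b := by
          intro x
          by_cases hxc : x = c
          · exact hxc ▸ hcK
          · exact (h.rel_of_ne hstep (fun x => .refl x) (fun _ _ _ h1 h2 => h1.trans h2)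
              hxc hdc).trans hdK
        exact ⟨fun x y => (hb x).trans (hb y).symm⟩
      rcases hall with hall | hall
      · exact ⟨a, b, .inl ⟨rfl, rfl⟩, hall⟩
      · exact ⟨b, a, .inr ⟨rfl, rfl⟩, hall⟩
  have hedges : H.edgeFinset.card + ((G.neighborFinset a).erase b).card +
      ((G.neighborFinset b).erase a).card ≤ G.edgeFinset.card :=
    card_edgesWithin_add_le hab haU hbU
  have hnbr : ∀ c d, G.Adj r c → r ≠ d → d ∉ U →
      (∑ v ∈ U, if G.Adj c v then 1 else 0) + 1 ≤ ((G.neighborFinset c).erase d).card := by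
    intro c d hrc hrd hdU
    rw [← Finset.card_filter, ← Finset.card_insert_of_notMem (a := r) (by simp [hrU])]
    refine Finset.card_le_card fun x hx => ?_
    rw [Finset.mem_insert, Finset.mem_filter] at hx
    rw [Finset.mem_erase, SimpleGraph.mem_neighborFinset]
    rcases hx with rfl | ⟨hxU, hcx⟩
    · exact ⟨hrd, hrc.symm⟩
    · exact ⟨fun e => hdU (e ▸ hxU), hcx⟩
  have hA := hnbr a b hra hrb.ne hbU
  have hB := hnbr b a hrb hra.ne haU
  have hHsum : ∑ v ∈ U, H.degree v = 2 * H.edgeFinset.card := by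
    rw [← H.sum_degrees_eq_twice_card_edges]
    exact Finset.sum_subset (Finset.subset_univ _) fun v _ hv => degree_edgesWithin_of_notMem hv
  have hQsum : ∑ v ∈ U, (if v ∈ Q then 1 else 0) = Q.card := by
    rw [← Finset.card_filter]
    congr 1
    ext v
    simp [hQ]
  have hpt : ∀ v ∈ U, 4 + (if v ∈ Q then 1 else 0) ≤ H.degree v +
      3 * (if G.Adj a v then 1 else 0) + 3 * (if G.Adj b v then 1 else 0) := by
    intro v hv
    have hd := hdegU v hv
    have hm := hmin v
    have hf := hfar v hv
    have hvQ : v ∈ Q ↔ (G.Adj a v ∧ G.Adj b v) ∨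
        ((G.Adj a v ∨ G.Adj b v) ∧ 2 ≤ H.degree v) := by simp [hQ, hv]
    by_cases h1 : G.Adj a v <;> by_cases h2 : G.Adj b v <;>
      simp only [hvQ, h1, h2, if_true, if_false, and_self, and_true, and_false, true_and,
        false_and, or_self, or_true, or_false, true_or, false_or, not_false_eq_true,
        forall_const] at hd hf ⊢ <;> try split_ifs
    all_goals omega
  have htot := Finset.sum_le_sum hpt
  simp only [Finset.sum_add_distrib, ← Finset.mul_sum, Finset.sum_const, smul_eq_mul, hHsum,
    hQsum] at htot
  omega

end Pebbling

/-- Every `n`-vertex Class 0 graph with diameter at least 3 and minimum degree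
exactly 2 has at least `(5/3)n - 11/3` edges. -/
theorem class0_edge_bound_minDegree_two {V : Type*} [Fintype V] [DecidableEq V]
    (G : SimpleGraph V) [DecidableRel G.Adj] (hG : G.Connected) (hG0 : Class0 G)
    (hdiam : 3 ≤ G.diam)
    (hmin : ∀ v : V, 2 ≤ G.degree v) (hmin' : ∃ v : V, G.degree v = 2) :
    (5 / 3 : ℝ) * Fintype.card V - 11 / 3 ≤ (G.edgeFinset.card : ℝ) := by
  obtain ⟨r, hr⟩ := hmin'
  have key : (5 : ℝ) * Fintype.card V ≤ 3 * G.edgeFinset.card + 10 := by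
    exact_mod_cast hG0.five_mul_card_le hG hmin hr
  linarith
end

section
/- For all positive integers p, q, and r, the graph G_{p,q,r} is Class 0 and has exactly 2n − 5 edges, where n = p + q + r + 4 is its number of vertices. -/
/-- The graph `G_{p,q,r}`: vertex set
`{v, a, b, c} ∪ {s₁, …, s_p} ∪ {t₁, …, t_q} ∪ {u₁, …, u_r}` where `v, a, b, c` are
encoded as `Sum.inl 0, Sum.inl 1, Sum.inl 2, Sum.inl 3`, with triangle edges
`ab, bc, ca`, and edges `v sᵢ`, `sᵢ a`, `v tⱼ`, `tⱼ b`, `v uₖ`, `uₖ c`. -/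
def Ggraph (p q r : ℕ) : SimpleGraph (Fin 4 ⊕ (Fin p ⊕ Fin q ⊕ Fin r)) :=
  SimpleGraph.fromRel fun x y =>
    match x, y with
    | Sum.inl i, Sum.inl j => i ≠ j ∧ i ≠ 0 ∧ j ≠ 0
    | Sum.inl i, Sum.inr (Sum.inl _) => i = 0 ∨ i = 1
    | Sum.inl i, Sum.inr (Sum.inr (Sum.inl _)) => i = 0 ∨ i = 2
    | Sum.inl i, Sum.inr (Sum.inr (Sum.inr _)) => i = 0 ∨ i = 3
    | _, _ => False

/-- The configuration `M` (a multiset of pebble positions) can be turned into the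
configuration `N` by pebbling moves. -/
def PebbleReach {V : Type*} [DecidableEq V] (G : SimpleGraph V) (M N : Multiset V) : Prop :=
  Relation.ReflTransGen (PebblingMove G) (fun x => M.count x) (fun x => N.count x)

/-- A pebbling move remains legal when further pebbles are present. -/
theorem PebblingMove.add_right {V : Type*} {G : SimpleGraph V} {p q : V → ℕ}
    (h : PebblingMove G p q) (d : V → ℕ) : PebblingMove G (p + d) (q + d) := by
  obtain ⟨u, v, huv, h2, hu, hv, hx⟩ := h
  refine ⟨u, v, huv, ?_, ?_, ?_, fun x h1 h2 => ?_⟩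
  · simp only [Pi.add_apply]; omega
  · simp only [Pi.add_apply]; omega
  · simp only [Pi.add_apply]; omega
  · simp only [Pi.add_apply, hx x h1 h2]

theorem reflTransGen_pebblingMove_add_right {V : Type*} {G : SimpleGraph V} {p q : V → ℕ}
    (h : Relation.ReflTransGen (PebblingMove G) p q) (d : V → ℕ) :
    Relation.ReflTransGen (PebblingMove G) (p + d) (q + d) :=
  Relation.ReflTransGen.lift (· + d) (fun _ _ hm => PebblingMove.add_right hm d) _ _ h

namespace PebbleReach

variable {V : Type*} [DecidableEq V] {G : SimpleGraph V} {M N P M' N' : Multiset V}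

theorem keep (M : Multiset V) : PebbleReach G M M := Relation.ReflTransGen.refl

theorem trans (h : PebbleReach G M N) (h' : PebbleReach G N P) : PebbleReach G M P :=
  Relation.ReflTransGen.trans h h'

theorem add_right (h : PebbleReach G M N) (P : Multiset V) :
    PebbleReach G (M + P) (N + P) := by
  simp only [PebbleReach, Multiset.count_add]
  exact reflTransGen_pebblingMove_add_right h (fun x => P.count x)

theorem add (h : PebbleReach G M N) (h' : PebbleReach G M' N') :
    PebbleReach G (M + M') (N + N') := by
  refine (h.add_right M').trans ?_
  rw [add_comm N, add_comm N]
  exact h'.add_right N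

theorem move {u w : V} (h : G.Adj u w) : PebbleReach G {u, u} {w} := by
  have hne := h.ne
  refine Relation.ReflTransGen.single ⟨u, w, h, ?_, ?_, ?_, fun x h1 h2 => ?_⟩
  · simp
  · simp [hne]
  · simp [hne.symm]
  · simp [h1, h2]

/-- Two pebbles at `u` and one at a common neighbor of `u` and `w` yield a pebble at `w`. -/
theorem via {u l w : V} (h : G.Adj u l) (h' : G.Adj l w) : PebbleReach G {u, u, l} {w} :=
  ((move h).add (keep {l})).trans (move h')

theorem four {u l w : V} (h : G.Adj u l) (h' : G.Adj l w) : PebbleReach G {u, u, u, u} {w} :=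
  ((move h).add (move h)).trans (move h')

theorem solvable {r : V} {p : V → ℕ} (h : PebbleReach G M {r}) (hM : ∀ x, M.count x ≤ p x) :
    PebblingSolvable G r p := by
  have hp : p = (fun x => M.count x) + fun x => p x - M.count x :=
    funext fun x => (Nat.add_sub_cancel' (hM x)).symm
  rw [hp]
  exact ⟨_, reflTransGen_pebblingMove_add_right h _, by simp⟩

end PebbleReach

/-- A graph with center `inl 0`, three pairwise adjacent hubs `inl 1`, `inl 2`, `inl 3`, and
legs `inr l`, each adjacent to the center and to the hub `inl (col l)`. -/
structure IsLegged {L : Type*} (G : SimpleGraph (Fin 4 ⊕ L)) (col : L → Fin 4) : Prop where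
  hub_adj : ∀ {i j : Fin 4}, i ≠ j → i ≠ 0 → j ≠ 0 → G.Adj (Sum.inl i) (Sum.inl j)
  center_adj : ∀ l, G.Adj (Sum.inl 0) (Sum.inr l)
  leg_adj : ∀ l, G.Adj (Sum.inr l) (Sum.inl (col l))
  col_ne : ∀ l, col l ≠ 0

section Counting

variable {L : Type*} [Fintype L]

theorem exists_multiset_pairs [DecidableEq L] (y : L → ℕ) {n : ℕ} (hn : n ≤ ∑ l, y l / 2) :
    ∃ A : Multiset L, A.card = n ∧ ∀ l, 2 * A.count l ≤ y l := by
  let B : Multiset L := ∑ l, Multiset.replicate (y l / 2) l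
  have hB : B.card = ∑ l, y l / 2 := by simp [B]
  obtain ⟨A, hA, hc⟩ : ∃ A ≤ B, A.card = n := by
    refine ⟨(B.toList.take n : List L), ?_, by simp [hB, hn]⟩
    conv_rhs => rw [← B.coe_toList]
    exact Multiset.coe_le.mpr (List.take_sublist _ _).subperm
  refine ⟨A, hc, fun l => ?_⟩
  have h1 := Multiset.count_le_of_le l hA
  have h2 : B.count l = y l / 2 := by
    simp [B, Multiset.count_sum', Multiset.count_replicate]
  omega

theorem sum_add_sum_even (y : L → ℕ) :
    ∑ l, y l + ∑ l, (1 - y l % 2) = Fintype.card L + 2 * ∑ l, y l / 2 := by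
  rw [Fintype.card_eq_sum_ones, Finset.mul_sum, ← Finset.sum_add_distrib,
    ← Finset.sum_add_distrib]
  exact Finset.sum_congr rfl fun l _ => by omega

theorem three_le_sum (f : L → ℕ) {a b c : L} (hab : a ≠ b) (hac : a ≠ c) (hbc : b ≠ c) :
    f a + f b + f c ≤ ∑ l, f l := by
  classical
  calc f a + f b + f c = ∑ l ∈ {a, b, c}, f l := by
        rw [Finset.sum_insert (by simp [hab, hac]), Finset.sum_pair hbc, add_assoc]
    _ ≤ ∑ l, f l := Finset.sum_le_sum_of_subset (Finset.subset_univ _)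

end Counting

namespace IsLegged

open PebbleReach

variable {L : Type*} {G : SimpleGraph (Fin 4 ⊕ L)} {col : L → Fin 4}

/-- With one leg of each color fixed, a configuration of size `|V|` satisfies a lower bound on
the pebbles available at the center, at the hubs and in pairs on the legs. -/
theorem counting [Fintype L] {p : Fin 4 ⊕ L → ℕ} (hp : ∑ x, p x = 4 + Fintype.card L)
    {a b c : L} (hab : col a ≠ col b) (hac : col a ≠ col c) (hbc : col b ≠ col c)
    (ha : col a ≠ 0) (hb : col b ≠ 0) (hc : col c ≠ 0) :
    4 + (1 - p (Sum.inr a) % 2) + (1 - p (Sum.inr b) % 2) + (1 - p (Sum.inr c) % 2) ≤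
      p (Sum.inl 0) + p (Sum.inl (col a)) + p (Sum.inl (col b)) + p (Sum.inl (col c))
        + 2 * ∑ l, p (Sum.inr l) / 2 := by
  have h1 := sum_add_sum_even fun l => p (Sum.inr l)
  have h2 := three_le_sum (fun l => 1 - p (Sum.inr l) % 2)
    (ne_of_apply_ne col hab) (ne_of_apply_ne col hac) (ne_of_apply_ne col hbc)
  have h3 : p (Sum.inl 0) + p (Sum.inl (col a)) + p (Sum.inl (col b)) + p (Sum.inl (col c))
      = ∑ i, p (Sum.inl i) := by
    have : (Finset.univ : Finset (Fin 4)) = {0, col a, col b, col c} := by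
      generalize col a = i at *
      generalize col b = j at *
      generalize col c = k at *
      revert i j k
      decide
    rw [this, Finset.sum_insert (by simp [ha.symm, hb.symm, hc.symm]),
      Finset.sum_insert (by simp [hab, hac]), Finset.sum_pair hbc]
    ring
  rw [Fintype.sum_sum_type] at hp
  omega

variable [DecidableEq L]

theorem leg_hub (h : IsLegged G col) (l : L) :
    PebbleReach G {Sum.inr l, Sum.inr l} {Sum.inl (col l)} := move (h.leg_adj l)

theorem leg_center (h : IsLegged G col) (l : L) :
    PebbleReach G {Sum.inr l, Sum.inr l} {Sum.inl 0} := move (h.center_adj l).symm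

theorem center_hub (h : IsLegged G col) (l : L) :
    PebbleReach G {Sum.inl 0, Sum.inl 0, Sum.inr l} {Sum.inl (col l)} :=
  via (h.center_adj l) (h.leg_adj l)

theorem hub_center (h : IsLegged G col) (l : L) :
    PebbleReach G {Sum.inl (col l), Sum.inl (col l), Sum.inr l} {Sum.inl 0} :=
  via (h.leg_adj l).symm (h.center_adj l).symm

theorem hub_hub (h : IsLegged G col) {l m : L} (hlm : col l ≠ col m) :
    PebbleReach G {Sum.inl (col l), Sum.inl (col l)} {Sum.inl (col m)} :=
  move (h.hub_adj hlm (h.col_ne l) (h.col_ne m))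

theorem four_hub (h : IsLegged G col) (l : L) : PebbleReach G
    {Sum.inl (col l), Sum.inl (col l), Sum.inl (col l), Sum.inl (col l)} {Sum.inl 0} :=
  four (h.leg_adj l).symm (h.center_adj l).symm

theorem four_center (h : IsLegged G col) (l : L) : PebbleReach G
    {Sum.inl 0, Sum.inl 0, Sum.inl 0, Sum.inl 0} {Sum.inl (col l)} :=
  four (h.center_adj l) (h.leg_adj l)

variable [Fintype L]

theorem solvable_center (h : IsLegged G col) {p : Fin 4 ⊕ L → ℕ}
    (hp : ∑ x, p x = 4 + Fintype.card L)
    {a b c : L} (hab : col a ≠ col b) (hac : col a ≠ col c) (hbc : col b ≠ col c) :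
    PebblingSolvable G (Sum.inl 0) p := by
  by_contra hns
  have hcount := counting hp hab hac hbc (h.col_ne a) (h.col_ne b) (h.col_ne c)
  have hK : ∑ l, p (Sum.inr l) / 2 = 0 := by
    by_contra hK
    obtain ⟨A, hA, hA2⟩ := exists_multiset_pairs (fun l => p (Sum.inr l))
      (Nat.one_le_iff_ne_zero.mpr hK)
    obtain ⟨l, rfl⟩ := Multiset.card_eq_one.mp hA
    refine hns ((h.leg_center l).solvable fun x => ?_)
    clear * - hA2
    grind [Multiset.insert_eq_cons, Multiset.count_add, Multiset.count_cons,
      Multiset.count_singleton]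
  have f0 : ¬ (1 ≤ p (Sum.inl 0)) := by
    refine fun hx => hns (PebbleReach.solvable
      (keep _)
      fun x => ?_)
    clear * - hx
    grind [Multiset.insert_eq_cons, Multiset.count_add, Multiset.count_cons,
      Multiset.count_singleton]
  have f1 (l : L) : ¬ (4 ≤ p (Sum.inl (col l))) := by
    refine fun hx => hns (PebbleReach.solvable
      (h.four_hub l)
      fun x => ?_)
    clear * - hx
    grind [Multiset.insert_eq_cons, Multiset.count_add, Multiset.count_cons,
      Multiset.count_singleton]
  have f2 (l : L) : ¬ (2 ≤ p (Sum.inl (col l)) ∧ p (Sum.inr l) % 2 = 1) := by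
    refine fun hx => hns (PebbleReach.solvable
      (h.hub_center l)
      fun x => ?_)
    clear * - hx
    grind [Multiset.insert_eq_cons, Multiset.count_add, Multiset.count_cons,
      Multiset.count_singleton]
  have f3 {l m : L} (hlm : col l ≠ col m) :
      ¬ (3 ≤ p (Sum.inl (col l)) ∧ 2 ≤ p (Sum.inl (col m))) := by
    refine fun hx => hns (PebbleReach.solvable
      (((keep {Sum.inl (col l), Sum.inl (col l), Sum.inl (col l)}).add (h.hub_hub hlm.symm)).trans
        (h.four_hub l))
      fun x => ?_)
    clear * - hx hlm
    grind [Multiset.insert_eq_cons, Multiset.count_add, Multiset.count_cons,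
      Multiset.count_singleton]
  have f4 {l m : L} (hlm : col l ≠ col m) :
      ¬ (2 ≤ p (Sum.inl (col l)) ∧ 1 ≤ p (Sum.inl (col m)) ∧ p (Sum.inr m) % 2 = 1) := by
    refine fun hx => hns (PebbleReach.solvable
      (((h.hub_hub hlm).add (keep {Sum.inl (col m), Sum.inr m})).trans (h.hub_center m))
      fun x => ?_)
    clear * - hx hlm
    grind [Multiset.insert_eq_cons, Multiset.count_add, Multiset.count_cons,
      Multiset.count_singleton]
  have := f1 a
  have := f1 b
  have := f1 c
  have := f2 a
  have := f2 b
  have := f2 c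
  have := f3 hab
  have := f3 hab.symm
  have := f3 hac
  have := f3 hac.symm
  have := f3 hbc
  have := f3 hbc.symm
  have := f4 hab
  have := f4 hab.symm
  have := f4 hac
  have := f4 hac.symm
  have := f4 hbc
  have := f4 hbc.symm
  lia

theorem solvable_hub (h : IsLegged G col) {p : Fin 4 ⊕ L → ℕ}
    (hp : ∑ x, p x = 4 + Fintype.card L)
    {a b c : L} (hab : col a ≠ col b) (hac : col a ≠ col c) (hbc : col b ≠ col c) :
    PebblingSolvable G (Sum.inl (col a)) p := by
  by_contra hns
  have hcount := counting hp hab hac hbc (h.col_ne a) (h.col_ne b) (h.col_ne c)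
  have hcol (i : Fin 4) (hi : i ≠ 0) : i = col a ∨ i = col b ∨ i = col c := by
    have := h.col_ne a
    have := h.col_ne b
    have := h.col_ne c
    grind
  have f0 : ¬ (1 ≤ p (Sum.inl (col a))) := by
    refine fun hx => hns (PebbleReach.solvable
      (keep _)
      fun x => ?_)
    clear * - hx
    grind [Multiset.insert_eq_cons, Multiset.count_add, Multiset.count_cons,
      Multiset.count_singleton]
  have f1 {l : L} (hl : col l ≠ col a) : ¬ (2 ≤ p (Sum.inl (col l))) := by
    refine fun hx => hns (PebbleReach.solvable
      (h.hub_hub hl)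
      fun x => ?_)
    clear * - hx hl
    grind [Multiset.insert_eq_cons, Multiset.count_add, Multiset.count_cons,
      Multiset.count_singleton]
  have f2 : ¬ (4 ≤ p (Sum.inl 0)) := by
    refine fun hx => hns (PebbleReach.solvable
      (h.four_center a)
      fun x => ?_)
    clear * - hx
    grind [Multiset.insert_eq_cons, Multiset.count_add, Multiset.count_cons,
      Multiset.count_singleton]
  have f3 : ¬ (2 ≤ p (Sum.inl 0) ∧ p (Sum.inr a) % 2 = 1) := by
    refine fun hx => hns (PebbleReach.solvable
      (h.center_hub a)
      fun x => ?_)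
    clear * - hx
    grind [Multiset.insert_eq_cons, Multiset.count_add, Multiset.count_cons,
      Multiset.count_singleton]
  have f4 {l : L} (hl : col l ≠ col a) :
      ¬ (2 ≤ p (Sum.inl 0) ∧ p (Sum.inr l) % 2 = 1 ∧ 1 ≤ p (Sum.inl (col l))) := by
    refine fun hx => hns (PebbleReach.solvable
      (((h.center_hub l).add (keep {Sum.inl (col l)})).trans (h.hub_hub hl)) fun x => ?_)
    have h0 := h.col_ne l
    clear * - hx hl h0
    grind [Multiset.insert_eq_cons, Multiset.count_add, Multiset.count_cons,
      Multiset.count_singleton]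
  have f5 {l : L} (hl : col l = col a) : ¬ (∀ z, 2 * Multiset.count z {l} ≤ p (Sum.inr z)) := by
    refine fun hx => hns (PebbleReach.solvable
      (hl ▸ h.leg_hub l)
      fun x => ?_)
    clear * - hx hl
    grind [Multiset.insert_eq_cons, Multiset.count_add, Multiset.count_cons,
      Multiset.count_singleton]
  have f6 {l m : L} (hl : col l ≠ col a) (hlm : col l = col m) :
      ¬ (∀ z, 2 * Multiset.count z {l, m} ≤ p (Sum.inr z)) := by
    refine fun hx => hns (PebbleReach.solvable
      (((h.leg_hub l).add (hlm ▸ h.leg_hub m)).trans (h.hub_hub hl))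
      fun x => ?_)
    clear * - hx hl hlm
    grind [Multiset.insert_eq_cons, Multiset.count_add, Multiset.count_cons,
      Multiset.count_singleton]
  have f7 {l : L} (hl : col l ≠ col a) :
      ¬ (1 ≤ p (Sum.inl (col l)) ∧ ∀ z, 2 * Multiset.count z {l} ≤ p (Sum.inr z)) := by
    refine fun hx => hns (PebbleReach.solvable
      (((keep {Sum.inl (col l)}).add (h.leg_hub l)).trans (h.hub_hub hl))
      fun x => ?_)
    clear * - hx hl
    grind [Multiset.insert_eq_cons, Multiset.count_add, Multiset.count_cons,
      Multiset.count_singleton]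
  have f8 (l m : L) :
      ¬ (p (Sum.inr a) % 2 = 1 ∧ ∀ z, 2 * Multiset.count z {l, m} ≤ p (Sum.inr z)) := by
    refine fun hx => hns (PebbleReach.solvable
      ((((h.leg_center l).add (h.leg_center m)).add (keep {Sum.inr a})).trans (h.center_hub a))
      fun x => ?_)
    clear * - hx
    grind [Multiset.insert_eq_cons, Multiset.count_add, Multiset.count_cons,
      Multiset.count_singleton]
  have f9 {l : L} (m : L) {n : L} (hl : col l ≠ col a) (hn : col n = col l) :
      ¬ (1 ≤ p (Sum.inl 0) ∧ p (Sum.inr n) % 2 = 1 ∧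
        ∀ z, 2 * Multiset.count z {l, m} ≤ p (Sum.inr z)) := by
    refine fun hx => hns (PebbleReach.solvable
      ((((((keep {Sum.inl 0}).add (h.leg_center m)).add (keep {Sum.inr n})).trans
        (hn ▸ h.center_hub n)).add (h.leg_hub l)).trans (h.hub_hub hl))
      fun x => ?_)
    clear * - hx hl hn
    grind [Multiset.insert_eq_cons, Multiset.count_add, Multiset.count_cons,
      Multiset.count_singleton]
  have f10 (l m : L) :
      ¬ (2 ≤ p (Sum.inl 0) ∧ ∀ z, 2 * Multiset.count z {l, m} ≤ p (Sum.inr z)) := by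
    refine fun hx => hns (PebbleReach.solvable
      ((((keep {Sum.inl 0, Sum.inl 0}).add (h.leg_center l)).add (h.leg_center m)).trans
        (h.four_center a))
      fun x => ?_)
    clear * - hx
    grind [Multiset.insert_eq_cons, Multiset.count_add, Multiset.count_cons,
      Multiset.count_singleton]
  have f11 (l : L) :
      ¬ (1 ≤ p (Sum.inl 0) ∧ p (Sum.inr a) % 2 = 1 ∧
        ∀ z, 2 * Multiset.count z {l} ≤ p (Sum.inr z)) := by
    refine fun hx => hns (PebbleReach.solvable
      ((((keep {Sum.inl 0}).add (h.leg_center l)).add (keep {Sum.inr a})).trans (h.center_hub a))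
      fun x => ?_)
    clear * - hx
    grind [Multiset.insert_eq_cons, Multiset.count_add, Multiset.count_cons,
      Multiset.count_singleton]
  have f12 (l : L) : ¬ (3 ≤ p (Sum.inl 0) ∧ ∀ z, 2 * Multiset.count z {l} ≤ p (Sum.inr z)) := by
    refine fun hx => hns (PebbleReach.solvable
      (((keep {Sum.inl 0, Sum.inl 0, Sum.inl 0}).add (h.leg_center l)).trans (h.four_center a))
      fun x => ?_)
    clear * - hx
    grind [Multiset.insert_eq_cons, Multiset.count_add, Multiset.count_cons,
      Multiset.count_singleton]
  have f13 {l n : L} (hl : col l ≠ col a) (hn : col n = col l) :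
      ¬ (2 ≤ p (Sum.inl 0) ∧ p (Sum.inr n) % 2 = 1 ∧
        ∀ z, 2 * Multiset.count z {l} ≤ p (Sum.inr z)) := by
    refine fun hx => hns (PebbleReach.solvable
      (((hn ▸ h.center_hub n).add (h.leg_hub l)).trans (h.hub_hub hl))
      fun x => ?_)
    clear * - hx hl hn
    grind [Multiset.insert_eq_cons, Multiset.count_add, Multiset.count_cons,
      Multiset.count_singleton]
  have := f1 hab.symm
  have := f1 hac.symm
  have := f4 hab.symm
  have := f4 hac.symm
  obtain hK | hK | hK | hK : ∑ l, p (Sum.inr l) / 2 = 0 ∨ ∑ l, p (Sum.inr l) / 2 = 1 ∨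
      ∑ l, p (Sum.inr l) / 2 = 2 ∨ 3 ≤ ∑ l, p (Sum.inr l) / 2 := by omega
  · omega
  · obtain ⟨A, hA, hA2⟩ := exists_multiset_pairs (fun l => p (Sum.inr l)) hK.ge
    obtain ⟨l, rfl⟩ := Multiset.card_eq_one.mp hA
    have := f11 l
    have := f12 l
    obtain hl | hl | hl := hcol _ (h.col_ne l)
    · exact f5 hl hA2
    · have := f7 (hl ▸ hab.symm)
      have := f13 (hl ▸ hab.symm) hl.symm
      grind
    · have := f7 (hl ▸ hac.symm)
      have := f13 (hl ▸ hac.symm) hl.symm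
      grind
  · obtain ⟨A, hA, hA2⟩ := exists_multiset_pairs (fun l => p (Sum.inr l)) hK.ge
    obtain ⟨l, m, rfl⟩ := Multiset.card_eq_two.mp hA
    have hl : ∀ z, 2 * Multiset.count z {l} ≤ p (Sum.inr z) := fun z => by
      have := hA2 z
      clear * - this
      grind [Multiset.insert_eq_cons, Multiset.count_cons, Multiset.count_singleton]
    have hm : ∀ z, 2 * Multiset.count z {m} ≤ p (Sum.inr z) := fun z => by
      have := hA2 z
      clear * - this
      grind [Multiset.insert_eq_cons, Multiset.count_cons, Multiset.count_singleton]
    have hla := fun e => f5 (l := l) e hl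
    have hma := fun e => f5 (l := m) e hm
    have hlm := fun e => f6 hla e hA2
    have := f7 hla
    have := f7 hma
    have := f8 l m
    have := f10 l m
    obtain ⟨e, e'⟩ | ⟨e, e'⟩ :
        col l = col b ∧ col m = col c ∨ col l = col c ∧ col m = col b := by
      have := hcol _ (h.col_ne l)
      have := hcol _ (h.col_ne m)
      clear hcol
      grind
    · have := f9 m hla e.symm
      grind
    · have := f9 m hla e.symm
      grind
  · obtain ⟨A, hA, hA2⟩ := exists_multiset_pairs (fun l => p (Sum.inr l)) hK
    obtain ⟨l, m, n, rfl⟩ := Multiset.card_eq_three.mp hA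
    have hl : ∀ z, 2 * Multiset.count z {l} ≤ p (Sum.inr z) := fun z => by
      have := hA2 z
      clear * - this
      grind [Multiset.insert_eq_cons, Multiset.count_cons, Multiset.count_singleton]
    have hm : ∀ z, 2 * Multiset.count z {m} ≤ p (Sum.inr z) := fun z => by
      have := hA2 z
      clear * - this
      grind [Multiset.insert_eq_cons, Multiset.count_cons, Multiset.count_singleton]
    have hlm : ∀ z, 2 * Multiset.count z {l, m} ≤ p (Sum.inr z) := fun z => by
      have := hA2 z
      clear * - this
      grind [Multiset.insert_eq_cons, Multiset.count_cons, Multiset.count_singleton]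
    have hln : ∀ z, 2 * Multiset.count z {l, n} ≤ p (Sum.inr z) := fun z => by
      have := hA2 z
      clear * - this
      grind [Multiset.insert_eq_cons, Multiset.count_cons, Multiset.count_singleton]
    have hmn : ∀ z, 2 * Multiset.count z {m, n} ≤ p (Sum.inr z) := fun z => by
      have := hA2 z
      clear * - this
      grind [Multiset.insert_eq_cons, Multiset.count_cons, Multiset.count_singleton]
    have hn : ∀ z, 2 * Multiset.count z {n} ≤ p (Sum.inr z) := fun z => by
      have := hA2 z
      clear * - this
      grind [Multiset.insert_eq_cons, Multiset.count_cons, Multiset.count_singleton]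
    have hla := fun e => f5 (l := l) e hl
    have hma := fun e => f5 (l := m) e hm
    have hna := fun e => f5 (l := n) e hn
    have hlm' := fun e => f6 hla e hlm
    have hln' := fun e => f6 hla e hln
    have hmn' := fun e => f6 hma e hmn
    have hl' := hcol _ (h.col_ne l)
    have hm' := hcol _ (h.col_ne m)
    have hn' := hcol _ (h.col_ne n)
    clear * - hla hma hna hlm' hln' hmn' hl' hm' hn'
    grind

theorem solvable_leg (h : IsLegged G col) {p : Fin 4 ⊕ L → ℕ}
    (hp : ∑ x, p x = 4 + Fintype.card L)
    {a b c : L} (hab : col a ≠ col b) (hac : col a ≠ col c) (hbc : col b ≠ col c) :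
    PebblingSolvable G (Sum.inr a) p := by
  by_contra hns
  have hcount := counting hp hab hac hbc (h.col_ne a) (h.col_ne b) (h.col_ne c)
  have hcol (i : Fin 4) (hi : i ≠ 0) : i = col a ∨ i = col b ∨ i = col c := by
    have := h.col_ne a
    have := h.col_ne b
    have := h.col_ne c
    grind
  have f0 : ¬ (1 ≤ p (Sum.inr a)) := by
    refine fun hx => hns (PebbleReach.solvable
      (keep _)
      fun x => ?_)
    clear * - hx
    grind [Multiset.insert_eq_cons, Multiset.count_add, Multiset.count_cons,
      Multiset.count_singleton]
  have f1 : ¬ (2 ≤ p (Sum.inl 0)) := by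
    refine fun hx => hns (PebbleReach.solvable
      (move (h.center_adj a))
      fun x => ?_)
    clear * - hx
    grind [Multiset.insert_eq_cons, Multiset.count_add, Multiset.count_cons,
      Multiset.count_singleton]
  have f2 : ¬ (2 ≤ p (Sum.inl (col a))) := by
    refine fun hx => hns (PebbleReach.solvable
      (move (h.leg_adj a).symm)
      fun x => ?_)
    clear * - hx
    grind [Multiset.insert_eq_cons, Multiset.count_add, Multiset.count_cons,
      Multiset.count_singleton]
  have f3 {l : L} (hl : col l ≠ col a) : ¬ (4 ≤ p (Sum.inl (col l))) := by
    refine fun hx => hns (PebbleReach.solvable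
      (((h.hub_hub hl).add (h.hub_hub hl)).trans (move (h.leg_adj a).symm))
      fun x => ?_)
    clear * - hx hl
    grind [Multiset.insert_eq_cons, Multiset.count_add, Multiset.count_cons,
      Multiset.count_singleton]
  have f4 {l : L} (hl : col l ≠ col a) : ¬ (1 ≤ p (Sum.inl (col a)) ∧ 2 ≤ p (Sum.inl (col l))) := by
    refine fun hx => hns (PebbleReach.solvable
      (((keep {Sum.inl (col a)}).add (h.hub_hub hl)).trans (move (h.leg_adj a).symm))
      fun x => ?_)
    clear * - hx hl
    grind [Multiset.insert_eq_cons, Multiset.count_add, Multiset.count_cons,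
      Multiset.count_singleton]
  have f5 : ¬ (2 ≤ p (Sum.inl (col b)) ∧ 2 ≤ p (Sum.inl (col c))) := by
    refine fun hx => hns (PebbleReach.solvable
      (((h.hub_hub hab.symm).add (h.hub_hub hac.symm)).trans (move (h.leg_adj a).symm))
      fun x => ?_)
    clear * - hx hbc
    grind [Multiset.insert_eq_cons, Multiset.count_add, Multiset.count_cons,
      Multiset.count_singleton]
  have f6 (l : L) : ¬ (1 ≤ p (Sum.inl 0) ∧ 2 ≤ p (Sum.inl (col l)) ∧ p (Sum.inr l) % 2 = 1) := by
    refine fun hx => hns (PebbleReach.solvable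
      (((keep {Sum.inl 0}).add (h.hub_center l)).trans (move (h.center_adj a)))
      fun x => ?_)
    have h0 := h.col_ne l
    clear * - hx h0
    grind [Multiset.insert_eq_cons, Multiset.count_add, Multiset.count_cons,
      Multiset.count_singleton]
  have g0 (l m : L) : ¬ (∀ z, 2 * Multiset.count z {l, m} ≤ p (Sum.inr z)) := by
    refine fun hx => hns (PebbleReach.solvable
      (((h.leg_center l).add (h.leg_center m)).trans (move (h.center_adj a)))
      fun x => ?_)
    clear * - hx
    grind [Multiset.insert_eq_cons, Multiset.count_add, Multiset.count_cons,
      Multiset.count_singleton]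
  have g1 (l : L) : ¬ (1 ≤ p (Sum.inl 0) ∧ ∀ z, 2 * Multiset.count z {l} ≤ p (Sum.inr z)) := by
    refine fun hx => hns (PebbleReach.solvable
      (((keep {Sum.inl 0}).add (h.leg_center l)).trans (move (h.center_adj a)))
      fun x => ?_)
    clear * - hx
    grind [Multiset.insert_eq_cons, Multiset.count_add, Multiset.count_cons,
      Multiset.count_singleton]
  have g2 {l : L} (hl : col l = col a) :
      ¬ (1 ≤ p (Sum.inl (col a)) ∧ ∀ z, 2 * Multiset.count z {l} ≤ p (Sum.inr z)) := by
    refine fun hx => hns (PebbleReach.solvable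
      (((keep {Sum.inl (col a)}).add (hl ▸ h.leg_hub l)).trans (move (h.leg_adj a).symm))
      fun x => ?_)
    clear * - hx hl
    grind [Multiset.insert_eq_cons, Multiset.count_add, Multiset.count_cons,
      Multiset.count_singleton]
  have g3 {l : L} (hl : col l ≠ col a) :
      ¬ (1 ≤ p (Sum.inl (col a)) ∧ 1 ≤ p (Sum.inl (col l)) ∧
        ∀ z, 2 * Multiset.count z {l} ≤ p (Sum.inr z)) := by
    refine fun hx => hns (PebbleReach.solvable
      (((keep {Sum.inl (col a)}).add (((keep {Sum.inl (col l)}).add (h.leg_hub l)).trans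
        (h.hub_hub hl))).trans (move (h.leg_adj a).symm))
      fun x => ?_)
    clear * - hx hl
    grind [Multiset.insert_eq_cons, Multiset.count_add, Multiset.count_cons,
      Multiset.count_singleton]
  have g4 (l n : L) :
      ¬ (2 ≤ p (Sum.inl (col n)) ∧ p (Sum.inr n) % 2 = 1 ∧
        ∀ z, 2 * Multiset.count z {l} ≤ p (Sum.inr z)) := by
    refine fun hx => hns (PebbleReach.solvable
      (((h.leg_center l).add (h.hub_center n)).trans (move (h.center_adj a)))
      fun x => ?_)
    clear * - hx
    grind [Multiset.insert_eq_cons, Multiset.count_add, Multiset.count_cons,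
      Multiset.count_singleton]
  have g5 {l : L} (hl : col l ≠ col a) :
      ¬ (3 ≤ p (Sum.inl (col l)) ∧ ∀ z, 2 * Multiset.count z {l} ≤ p (Sum.inr z)) := by
    refine fun hx => hns (PebbleReach.solvable
      (((h.hub_hub hl).add (((keep {Sum.inl (col l)}).add (h.leg_hub l)).trans (h.hub_hub hl))).trans
        (move (h.leg_adj a).symm))
      fun x => ?_)
    clear * - hx hl
    grind [Multiset.insert_eq_cons, Multiset.count_add, Multiset.count_cons,
      Multiset.count_singleton]
  have g6 {l n : L} (hl : col l = col a) (hn : col n ≠ col a) :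
      ¬ (2 ≤ p (Sum.inl (col n)) ∧ ∀ z, 2 * Multiset.count z {l} ≤ p (Sum.inr z)) := by
    refine fun hx => hns (PebbleReach.solvable
      (((hl ▸ h.leg_hub l).add (h.hub_hub hn)).trans (move (h.leg_adj a).symm))
      fun x => ?_)
    clear * - hx hl hn
    grind [Multiset.insert_eq_cons, Multiset.count_add, Multiset.count_cons,
      Multiset.count_singleton]
  have g7 {l n : L} (hl : col l ≠ col a) (hn : col n ≠ col a) (hln : col l ≠ col n) :
      ¬ (1 ≤ p (Sum.inl (col l)) ∧ 2 ≤ p (Sum.inl (col n)) ∧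
        ∀ z, 2 * Multiset.count z {l} ≤ p (Sum.inr z)) := by
    refine fun hx => hns (PebbleReach.solvable
      (((((keep {Sum.inl (col l)}).add (h.leg_hub l)).trans (h.hub_hub hl)).add (h.hub_hub hn)).trans
        (move (h.leg_adj a).symm))
      fun x => ?_)
    clear * - hx hl hn hln
    grind [Multiset.insert_eq_cons, Multiset.count_add, Multiset.count_cons,
      Multiset.count_singleton]
  have := f3 hab.symm
  have := f3 hac.symm
  have := f4 hab.symm
  have := f4 hac.symm
  have := f6 b
  have := f6 c
  obtain hK | hK | hK : ∑ l, p (Sum.inr l) / 2 = 0 ∨ ∑ l, p (Sum.inr l) / 2 = 1 ∨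
      2 ≤ ∑ l, p (Sum.inr l) / 2 := by omega
  · omega
  · obtain ⟨A, hA, hA2⟩ := exists_multiset_pairs (fun l => p (Sum.inr l)) hK.ge
    obtain ⟨l, rfl⟩ := Multiset.card_eq_one.mp hA
    have := g1 l
    have := g4 l b
    have := g4 l c
    obtain hl | hl | hl := hcol _ (h.col_ne l)
    · have := g2 hl
      have := g6 hl hab.symm
      have := g6 hl hac.symm
      grind
    · have hla := hl ▸ hab.symm
      have := g3 hla
      have := g5 hla
      have := g7 hla hac.symm (hl ▸ hbc)
      grind
    · have hla := hl ▸ hac.symm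
      have := g3 hla
      have := g5 hla
      have := g7 hla hab.symm (hl ▸ hbc.symm)
      grind
  · obtain ⟨A, hA, hA2⟩ := exists_multiset_pairs (fun l => p (Sum.inr l)) hK
    obtain ⟨l, m, rfl⟩ := Multiset.card_eq_two.mp hA
    exact g0 l m hA2

end IsLegged

theorem not_pebblingSolvable_of_le_one {V : Type*} {G : SimpleGraph V} {r : V} {p : V → ℕ}
    (hp : ∀ x, p x ≤ 1) (hr : p r = 0) : ¬ PebblingSolvable G r p := by
  rintro ⟨q, hq, h1⟩
  obtain rfl | ⟨c, ⟨u, v, -, h2, -⟩, -⟩ := Relation.ReflTransGen.cases_head hq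
  · omega
  · have := hp u
    omega

/-- A graph is Class 0 as soon as configurations of size `|V|` are solvable for all roots. -/
theorem class0_of_solvable {V : Type*} [Fintype V] [Nonempty V] {G : SimpleGraph V}
    (h : ∀ (r : V) (p : V → ℕ), ∑ v, p v = Fintype.card V → PebblingSolvable G r p) :
    Class0 G := by
  classical
  refine le_antisymm (Nat.sInf_le h) (le_csInf ⟨_, h⟩ fun k hk => ?_)
  by_contra! hlt
  obtain ⟨r⟩ := ‹Nonempty V›
  obtain ⟨S, hS, hc⟩ := Finset.exists_subset_card_eq (s := Finset.univ.erase r) (n := k)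
    (by rw [Finset.card_erase_of_mem (Finset.mem_univ r), Finset.card_univ]; omega)
  have hr : r ∉ S := fun hr => by simpa using hS hr
  refine not_pebblingSolvable_of_le_one (p := fun x => if x ∈ S then 1 else 0) ?_ ?_
    (hk r _ ?_)
  · intro x
    split_ifs <;> omega
  · simp [hr]
  · simp [hc]

namespace IsLegged

variable {L : Type*} [Fintype L] {G : SimpleGraph (Fin 4 ⊕ L)} {col : L → Fin 4}

theorem class0 (h : IsLegged G col) (hsurj : ∀ i, i ≠ 0 → ∃ l, col l = i) : Class0 G := by
  classical
  refine class0_of_solvable fun root p hp => ?_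
  rw [Fintype.card_sum, Fintype.card_fin] at hp
  have others (i : Fin 4) (hi : i ≠ 0) : ∃ b c, i ≠ col b ∧ i ≠ col c ∧ col b ≠ col c := by
    obtain ⟨j, k, hj, hk, hij, hik, hjk⟩ :
        ∃ j k : Fin 4, j ≠ 0 ∧ k ≠ 0 ∧ i ≠ j ∧ i ≠ k ∧ j ≠ k := by
      revert i
      decide
    obtain ⟨b, rfl⟩ := hsurj j hj
    obtain ⟨c, rfl⟩ := hsurj k hk
    exact ⟨b, c, hij, hik, hjk⟩
  obtain i | a := root
  · obtain rfl | hi := eq_or_ne i 0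
    · obtain ⟨a, ha⟩ := hsurj 1 (by decide)
      obtain ⟨b, c, hab, hac, hbc⟩ := others (col a) (h.col_ne a)
      exact h.solvable_center hp hab hac hbc
    · obtain ⟨a, rfl⟩ := hsurj i hi
      obtain ⟨b, c, hab, hac, hbc⟩ := others (col a) hi
      exact h.solvable_hub hp hab hac hbc
  · obtain ⟨b, c, hab, hac, hbc⟩ := others (col a) (h.col_ne a)
    exact h.solvable_leg hp hab hac hbc

end IsLegged

/-- The index of the triangle vertex adjacent to a degree-two vertex of `Ggraph p q r`. -/
def legColor (p q r : ℕ) : Fin p ⊕ Fin q ⊕ Fin r → Fin 4 :=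
  Sum.elim (fun _ => 1) (Sum.elim (fun _ => 2) fun _ => 3)

section Ggraph

variable (p q r : ℕ)

theorem Ggraph_adj_inl_inl (i j : Fin 4) :
    (Ggraph p q r).Adj (Sum.inl i) (Sum.inl j) ↔ i ≠ j ∧ i ≠ 0 ∧ j ≠ 0 := by
  simp only [Ggraph, SimpleGraph.fromRel_adj, ne_eq, Sum.inl.injEq]
  tauto

theorem Ggraph_adj_inl_inr (i : Fin 4) (l : Fin p ⊕ Fin q ⊕ Fin r) :
    (Ggraph p q r).Adj (Sum.inl i) (Sum.inr l) ↔ i = 0 ∨ i = legColor p q r l := by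
  obtain l | l | l := l <;> simp [Ggraph, legColor]

theorem Ggraph_not_adj_inr_inr (l m : Fin p ⊕ Fin q ⊕ Fin r) :
    ¬ (Ggraph p q r).Adj (Sum.inr l) (Sum.inr m) := by
  simp [Ggraph]

theorem isLegged_Ggraph : IsLegged (Ggraph p q r) (legColor p q r) where
  hub_adj hij hi hj := (Ggraph_adj_inl_inl p q r _ _).mpr ⟨hij, hi, hj⟩
  center_adj l := (Ggraph_adj_inl_inr p q r _ l).mpr (Or.inl rfl)
  leg_adj l := ((Ggraph_adj_inl_inr p q r _ l).mpr (Or.inr rfl)).symm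
  col_ne l := by obtain l | l | l := l <;> simp [legColor]

/-- An enumeration of the edges of `Ggraph p q r`: the triangle, then the edges at the center,
then the remaining edges at the degree-two vertices. -/
def GgraphEdge : Fin 3 ⊕ (Fin p ⊕ Fin q ⊕ Fin r) ⊕ (Fin p ⊕ Fin q ⊕ Fin r) →
    Sym2 (Fin 4 ⊕ (Fin p ⊕ Fin q ⊕ Fin r))
  | Sum.inl i => s(Sum.inl i.succ, Sum.inl (i + 1).succ)
  | Sum.inr (Sum.inl l) => s(Sum.inl 0, Sum.inr l)
  | Sum.inr (Sum.inr l) => s(Sum.inl (legColor p q r l), Sum.inr l)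

theorem GgraphEdge_injective : Function.Injective (GgraphEdge p q r) := by
  rintro (i | l | l) (j | m | m) h
  · have : i = j := by
      simp only [GgraphEdge, Sym2.eq_iff, Sum.inl.injEq] at h
      revert i j
      decide
    rw [this]
  all_goals
    have hl := (isLegged_Ggraph p q r).col_ne
    simp only [GgraphEdge, Sym2.eq_iff, reduceCtorEq, Sum.inl.injEq, Sum.inr.injEq] at h
    grind

theorem range_GgraphEdge : Set.range (GgraphEdge p q r) = (Ggraph p q r).edgeSet := by
  ext e
  constructor
  · rintro ⟨i | l | l, rfl⟩
    · refine (Ggraph_adj_inl_inl p q r _ _).mpr ?_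
      revert i
      decide
    · exact (isLegged_Ggraph p q r).center_adj l
    · exact ((isLegged_Ggraph p q r).leg_adj l).symm
  · have key (i : Fin 4) (l) (h : (Ggraph p q r).Adj (Sum.inl i) (Sum.inr l)) :
        s(Sum.inl i, Sum.inr l) ∈ Set.range (GgraphEdge p q r) := by
      obtain rfl | rfl := (Ggraph_adj_inl_inr p q r i l).mp h
      · exact ⟨Sum.inr (Sum.inl l), rfl⟩
      · exact ⟨Sum.inr (Sum.inr l), rfl⟩
    induction e with
    | h x y =>
      intro h
      obtain i | l := x <;> obtain j | m := y
      · have hij := (Ggraph_adj_inl_inl p q r i j).mp h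
        obtain ⟨k, hk⟩ : ∃ k : Fin 3, i = k.succ ∧ j = (k + 1).succ ∨
            i = (k + 1).succ ∧ j = k.succ := by
          clear h
          revert i j
          decide
        exact ⟨Sum.inl k, by simp only [GgraphEdge, Sym2.eq_iff, Sum.inl.injEq]; tauto⟩
      · exact key i m h
      · rw [Sym2.eq_swap]
        exact key j l h.symm
      · exact (Ggraph_not_adj_inr_inr p q r l m h).elim

end Ggraph

/-- For all positive `p, q, r`, the graph `G_{p,q,r}` is Class 0 and has exactly
`2n - 5` edges, where `n = p + q + r + 4` is its number of vertices. -/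
theorem class0_Ggraph (p q r : ℕ) (hp : 0 < p) (hq : 0 < q) (hr : 0 < r) :
    Class0 (Ggraph p q r) ∧
      (Ggraph p q r).edgeSet.ncard = 2 * (p + q + r + 4) - 5 := by
  refine ⟨(isLegged_Ggraph p q r).class0 fun i hi => ?_, ?_⟩
  · obtain rfl | rfl | rfl : i = 1 ∨ i = 2 ∨ i = 3 := by
      revert i
      decide
    · exact ⟨Sum.inl ⟨0, hp⟩, rfl⟩
    · exact ⟨Sum.inr (Sum.inl ⟨0, hq⟩), rfl⟩
    · exact ⟨Sum.inr (Sum.inr ⟨0, hr⟩), rfl⟩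
  · rw [← range_GgraphEdge, ← Set.image_univ,
      Set.ncard_image_of_injective _ (GgraphEdge_injective p q r), Set.ncard_univ,
      Nat.card_eq_fintype_card]
    simp only [Fintype.card_sum, Fintype.card_fin]
    omega
end
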